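/- arXiv:1405.1701 — 2 statements merged into one kernel-verified Lean document; each statement's English description precedes it below -/
import Mathlib

section
/- Let 𝓓 = (Ω, 𝓑) be a supersimple 2-(n,4,2) design with n ≥ 10, let ∞ ∈ Ω, and suppose G = π_∞(𝓓) is transitive on Ω \ {∞} and preserves a system of imprimitivity with ℓ blocks each of size k. Then k = 2 or k = 4. -/
open Equiv

variable {Ω : Type*} [DecidableEq Ω] [Fintype Ω]

/-- Two points of a 4-hypergraph are collinear if they are equal or some line contains both. -/
def HGCollinear (B : Finset (Finset Ω)) (x y : Ω) : Prop :=
  x = y ∨ ∃ b ∈ B, x ∈ b ∧ y ∈ b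

/-- A 4-hypergraph is pliable if any two lines sharing three pairwise distinct points are equal. -/
def HGPliable (B : Finset (Finset Ω)) : Prop :=
  ∀ b₁ ∈ B, ∀ b₂ ∈ B, ∀ p q r : Ω, p ≠ q → p ≠ r → q ≠ r →
    p ∈ b₁ → q ∈ b₁ → r ∈ b₁ → p ∈ b₂ → q ∈ b₂ → r ∈ b₂ → b₁ = b₂

/-- `g` is the elementary move `[x,y]`: it interchanges `x` and `y`, interchanges the
remaining two points of every line through `x` and `y`, and fixes everything else.
For `x = y` it is the identity. -/
def IsElemMove (B : Finset (Finset Ω)) (x y : Ω) (g : Equiv.Perm Ω) : Prop :=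
  (x = y ∧ g = 1) ∨
  (x ≠ y ∧ (∃ b ∈ B, x ∈ b ∧ y ∈ b) ∧ g x = y ∧ g y = x ∧
    ∀ z : Ω, z ≠ x → z ≠ y →
      ((∀ b ∈ B, ¬(x ∈ b ∧ y ∈ b ∧ z ∈ b)) → g z = z) ∧
      (∀ b ∈ B, x ∈ b → y ∈ b → z ∈ b →
        ∀ w ∈ b, w ≠ x → w ≠ y → w ≠ z → g z = w))

/-- `g` is the move sequence `[a₀,…,a_k]` recorded by the list
(elementary moves applied left to right). -/
def IsMoveSeq (B : Finset (Finset Ω)) : List Ω → Equiv.Perm Ω → Prop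
  | [], _ => False
  | [_], g => g = 1
  | a :: b :: l, g => ∃ e h : Equiv.Perm Ω,
      IsElemMove B a b e ∧ IsMoveSeq B (b :: l) h ∧ g = h * e

/-- The puzzle set `𝓛_𝓓` of all move sequences. -/
def puzzleSet (B : Finset (Finset Ω)) : Set (Equiv.Perm Ω) :=
  { g | ∃ l : List Ω, IsMoveSeq B l g }

/-- The hole stabiliser `π_x(𝓓)`: all closed move sequences starting and ending at `x`. -/
def holeStab (B : Finset (Finset Ω)) (x : Ω) : Set (Equiv.Perm Ω) :=
  { g | ∃ l : List Ω, l.head? = some x ∧ l.getLast? = some x ∧ IsMoveSeq B l g }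

/-- `(Ω, B)` is a 2-(n,4,λ) design: lines have four points and every pair of distinct
points lies in exactly `lam` lines. -/
def IsTwoDesign (B : Finset (Finset Ω)) (lam : ℕ) : Prop :=
  (∀ b ∈ B, b.card = 4) ∧
  ∀ p q : Ω, p ≠ q → (B.filter fun b => p ∈ b ∧ q ∈ b).card = lam

/-- Supersimple: any two distinct lines meet in at most two points. -/
def HGSupersimple (B : Finset (Finset Ω)) : Prop :=
  ∀ b₁ ∈ B, ∀ b₂ ∈ B, b₁ ≠ b₂ → (b₁ ∩ b₂).card ≤ 2

/-- `x ∈ overline{a,c}`: `x` is `a`, `c`, or lies on a line containing both `a` and `c`. -/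
def HGLineClosure (B : Finset (Finset Ω)) (a c x : Ω) : Prop :=
  x = a ∨ x = c ∨ ∃ b ∈ B, a ∈ b ∧ c ∈ b ∧ x ∈ b

/-- A system of imprimitivity for the hole stabiliser `π_x` acting on `Ω \ {x}`,
with `ℓ` blocks each of size `k`. -/
def IsHoleBlockSystem (B : Finset (Finset Ω)) (x : Ω) (P : Finset (Finset Ω))
    (k ℓ : ℕ) : Prop :=
  P.card = ℓ ∧ 1 < k ∧ 1 < ℓ ∧ (∀ Δ ∈ P, Δ.card = k) ∧
  (∀ a : Ω, a ≠ x → ∃! Δ : Finset Ω, Δ ∈ P ∧ a ∈ Δ) ∧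
  (∀ Δ ∈ P, x ∉ Δ) ∧
  (∀ g ∈ holeStab B x, ∀ Δ ∈ P, Δ.image (⇑g) ∈ P)

set_option linter.unusedSectionVars false

/-- The four points `a, b, c, d` make up a line of `B`. -/
def QuadLine (B : Finset (Finset Ω)) (a b c d : Ω) : Prop :=
  ({a, b, c, d} : Finset Ω) ∈ B

namespace QuadLine

variable {B : Finset (Finset Ω)} {a b c d : Ω}

lemma swap_first (h : QuadLine B a b c d) : QuadLine B b a c d := by
  have : ({b, a, c, d} : Finset Ω) = {a, b, c, d} := by ext; simp; tauto
  rwa [QuadLine, this]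

lemma swap_last (h : QuadLine B a b c d) : QuadLine B a b d c := by
  have : ({a, b, d, c} : Finset Ω) = {a, b, c, d} := by ext; simp; tauto
  rwa [QuadLine, this]

lemma swap_mid (h : QuadLine B a b c d) : QuadLine B a c b d := by
  have : ({a, c, b, d} : Finset Ω) = {a, b, c, d} := by ext; simp; tauto
  rwa [QuadLine, this]

end QuadLine

lemma IsTwoDesign.quadLine_ne {B : Finset (Finset Ω)} (hdes : IsTwoDesign B 2) {a b c d : Ω}
    (h : QuadLine B a b c d) : a ≠ b ∧ a ≠ c ∧ a ≠ d ∧ b ≠ c ∧ b ≠ d ∧ c ≠ d := by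
  have h4 := hdes.1 _ h
  have key : ∀ p q r : Ω, ¬ ({a, b, c, d} : Finset Ω) ⊆ {p, q, r} := fun p q r hs => by
    have := Finset.card_le_card hs
    have := Finset.card_le_three (a := p) (b := q) (c := r)
    omega
  refine ⟨?_, ?_, ?_, ?_, ?_, ?_⟩ <;> rintro rfl
  · exact key a c d (by intro z; simp)
  · exact key a b d (by intro z; simp; tauto)
  · exact key a b c (by intro z; simp; tauto)
  · exact key a b d (by intro z; simp)
  · exact key a b c (by intro z; simp; tauto)
  · exact key a b c (by intro z; simp)

lemma exists_quadLine {B : Finset (Finset Ω)} (hdes : IsTwoDesign B 2) {s : Finset Ω}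
    (hs : s ∈ B) {p q : Ω} (hpq : p ≠ q) (hp : p ∈ s) (hq : q ∈ s) :
    ∃ c d, s = {p, q, c, d} := by
  have h4 := hdes.1 s hs
  have h2 : ((s.erase p).erase q).card = 2 := by
    rw [Finset.card_erase_of_mem (by simp [hq, hpq.symm]), Finset.card_erase_of_mem hp, h4]
  obtain ⟨c, d, -, hcd⟩ := Finset.card_eq_two.1 h2
  refine ⟨c, d, ?_⟩
  rw [← hcd, Finset.insert_erase (by simp [hq, hpq.symm]), Finset.insert_erase hp]

lemma HGSupersimple.quadLine_unique {B : Finset (Finset Ω)} (hdes : IsTwoDesign B 2)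
    (hss : HGSupersimple B) {a b c d e : Ω}
    (h : QuadLine B a b c d) (h' : QuadLine B a b c e) : d = e := by
  by_contra hde
  have h1 := hdes.quadLine_ne h
  have h2 := hdes.quadLine_ne h'
  have hne : ({a, b, c, d} : Finset Ω) ≠ {a, b, c, e} := fun heq => by
    have : d ∈ ({a, b, c, e} : Finset Ω) := heq ▸ (by simp)
    simp only [Finset.mem_insert, Finset.mem_singleton] at this
    tauto
  have h3 := hss _ h _ h' hne
  have h4 : ({a, b, c} : Finset Ω) ⊆ {a, b, c, d} ∩ {a, b, c, e} := by
    intro z; simp; tauto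
  have h5 : ({a, b, c} : Finset Ω).card = 3 := Finset.card_eq_three.2 ⟨a, b, c, by tauto⟩
  have := Finset.card_le_card h4
  omega

/-- Points `c, d` and `e, f` of the two lines through `p, q`, which are distinct lines. -/
structure LinePair (B : Finset (Finset Ω)) (p q c d e f : Ω) : Prop where
  fst : QuadLine B p q c d
  snd : QuadLine B p q e f
  ne₁ : c ≠ e
  ne₂ : c ≠ f
  ne₃ : d ≠ e
  ne₄ : d ≠ f

namespace LinePair

variable {B : Finset (Finset Ω)} {p q c d e f : Ω}

lemma swap_points (h : LinePair B p q c d e f) : LinePair B q p c d e f :=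
  ⟨h.1.swap_first, h.2.swap_first, h.3, h.4, h.5, h.6⟩

lemma swap_lines (h : LinePair B p q c d e f) : LinePair B p q e f c d :=
  ⟨h.2, h.1, h.3.symm, h.5.symm, h.4.symm, h.6.symm⟩

lemma swap_fst (h : LinePair B p q c d e f) : LinePair B p q d c e f :=
  ⟨h.1.swap_last, h.2, h.5, h.6, h.3, h.4⟩

lemma swap_snd (h : LinePair B p q c d e f) : LinePair B p q c d f e :=
  ⟨h.1, h.2.swap_last, h.4, h.3, h.6, h.5⟩

end LinePair

lemma exists_linePair {B : Finset (Finset Ω)} (hdes : IsTwoDesign B 2)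
    (hss : HGSupersimple B) {p q c d : Ω} (h : QuadLine B p q c d) :
    ∃ e f, LinePair B p q c d e f := by
  have hne := hdes.quadLine_ne h
  have h2 := hdes.2 p q hne.1
  obtain ⟨s, hs, hsne⟩ := Finset.exists_mem_ne
    (by omega : 1 < (B.filter fun b => p ∈ b ∧ q ∈ b).card) ({p, q, c, d} : Finset Ω)
  simp only [Finset.mem_filter] at hs
  obtain ⟨e, f, rfl⟩ := exists_quadLine hdes hs.1 hne.1 hs.2.1 hs.2.2
  have h' : QuadLine B p q e f := hs.1
  have key : ∀ {c' d' e' f'}, QuadLine B p q c' d' → QuadLine B p q e' f' → c' = e' → d' = f' := by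
    rintro c' d' e' f' h1 h2 rfl
    exact hss.quadLine_unique hdes h1 h2
  refine ⟨e, f, h, h', fun hh => ?_, fun hh => ?_, fun hh => ?_, fun hh => ?_⟩
  · exact hsne (by rw [key h h' hh, hh])
  · exact hsne (by rw [key h h'.swap_last hh, hh, Finset.pair_comm])
  · exact hsne (by rw [key h.swap_last h' hh, hh, Finset.pair_comm])
  · exact hsne (by rw [key h.swap_last h'.swap_last hh, hh])

lemma exists_linePair_of_ne {B : Finset (Finset Ω)} (hdes : IsTwoDesign B 2)
    (hss : HGSupersimple B) {p q : Ω} (h : p ≠ q) :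
    ∃ c d e f, LinePair B p q c d e f := by
  have h2 := hdes.2 p q h
  obtain ⟨s, hs⟩ := Finset.card_pos.1 (by omega : 0 < (B.filter fun b => p ∈ b ∧ q ∈ b).card)
  simp only [Finset.mem_filter] at hs
  obtain ⟨c, d, rfl⟩ := exists_quadLine hdes hs.1 h hs.2.1 hs.2.2
  exact ⟨c, d, exists_linePair hdes hss hs.1⟩

lemma LinePair.line_cases {B : Finset (Finset Ω)} (hdes : IsTwoDesign B 2)
    (hss : HGSupersimple B) {p q c d e f u v : Ω} (h : LinePair B p q c d e f)
    (huv : QuadLine B p q u v) :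
    (u = c ∧ v = d) ∨ (u = d ∧ v = c) ∨ (u = e ∧ v = f) ∨ (u = f ∧ v = e) := by
  have hne := hdes.quadLine_ne huv
  have hne1 := hdes.quadLine_ne h.1
  have hne2 := hdes.quadLine_ne h.2
  have h2 := hdes.2 p q hne.1
  have key : ∀ {c' d' e' f'}, QuadLine B p q c' d' → QuadLine B p q e' f' → c' = e' → d' = f' := by
    rintro c' d' e' f' h1 h2 rfl
    exact hss.quadLine_unique hdes h1 h2
  by_contra hcon
  have hc : u ≠ c := fun hh => hcon (Or.inl ⟨hh, key huv h.1 hh⟩)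
  have hd : u ≠ d := fun hh => hcon (Or.inr (Or.inl ⟨hh, key huv h.1.swap_last hh⟩))
  have he : u ≠ e := fun hh => hcon (Or.inr (Or.inr (Or.inl ⟨hh, key huv h.2 hh⟩)))
  have hf : u ≠ f := fun hh => hcon (Or.inr (Or.inr (Or.inr ⟨hh, key huv h.2.swap_last hh⟩)))
  have hsub : ({{p, q, c, d}, {p, q, e, f}, {p, q, u, v}} : Finset (Finset Ω)) ⊆
      B.filter fun b => p ∈ b ∧ q ∈ b := by
    have h1 := h.1
    have h2 := h.2
    unfold QuadLine at h1 h2 huv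
    intro s hs
    simp only [Finset.mem_insert, Finset.mem_singleton] at hs
    rcases hs with rfl | rfl | rfl <;> simp [h1, h2, huv]
  have hcard : ({{p, q, c, d}, {p, q, e, f}, {p, q, u, v}} : Finset (Finset Ω)).card = 3 := by
    have hu : u ∈ ({p, q, u, v} : Finset Ω) := by simp
    have hc' : c ∈ ({p, q, c, d} : Finset Ω) := by simp
    have hc'' : c ∉ ({p, q, e, f} : Finset Ω) := by
      simp [h.3, h.4, hne1.2.1.symm, hne1.2.2.2.1.symm]
    have hu₁ : u ∉ ({p, q, c, d} : Finset Ω) := by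
      simp [hc, hd, hne.2.1.symm, hne.2.2.2.1.symm]
    have hu₂ : u ∉ ({p, q, e, f} : Finset Ω) := by
      simp [he, hf, hne.2.1.symm, hne.2.2.2.1.symm]
    refine Finset.card_eq_three.2 ⟨_, _, _, ?_, ?_, ?_, rfl⟩ <;> intro heq
    · exact hc'' (heq ▸ hc')
    · exact hu₁ (heq ▸ hu)
    · exact hu₂ (heq ▸ hu)
  have := Finset.card_le_card hsub
  omega

/-- The permutation underlying the elementary move `[p,q]` when the two lines through `p, q` are
`{p,q,c,d}` and `{p,q,e,f}`. -/
def pairMove (p q c d e f : Ω) : Equiv.Perm Ω := swap p q * swap c d * swap e f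

lemma LinePair.isElemMove {B : Finset (Finset Ω)} (hdes : IsTwoDesign B 2)
    (hss : HGSupersimple B) {p q c d e f : Ω} (h : LinePair B p q c d e f) :
    IsElemMove B p q (pairMove p q c d e f) := by
  have hne1 := hdes.quadLine_ne h.1
  have hne2 := hdes.quadLine_ne h.2
  have ne1 := h.3
  have ne2 := h.4
  have ne3 := h.5
  have ne4 := h.6
  refine Or.inr ⟨hne1.1, ⟨_, h.1, by simp, by simp⟩, ?_, ?_, fun z hzp hzq => ⟨fun hz => ?_, ?_⟩⟩
  · simp only [pairMove, Perm.mul_apply, swap_apply_def]; grind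
  · simp only [pairMove, Perm.mul_apply, swap_apply_def]; grind
  · have h1 := hz _ h.1
    have h2 := hz _ h.2
    simp only [Finset.mem_insert, Finset.mem_singleton, true_or, or_true, true_and, not_or] at h1 h2
    simp only [pairMove, Perm.mul_apply, swap_apply_def]; grind
  · intro b hb hpb hqb hzb w hw hwp hwq hwz
    obtain ⟨u, v, rfl⟩ := exists_quadLine hdes hb hne1.1 hpb hqb
    have huv := h.line_cases hdes hss hb
    simp only [Finset.mem_insert, Finset.mem_singleton] at hzb hw
    simp only [pairMove, Perm.mul_apply, swap_apply_def]
    grind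

namespace LinePair

variable {B : Finset (Finset Ω)} {p q c d e f : Ω}

lemma pairMove_apply (hdes : IsTwoDesign B 2) (h : LinePair B p q c d e f) :
    pairMove p q c d e f p = q ∧ pairMove p q c d e f q = p ∧ pairMove p q c d e f c = d ∧
      pairMove p q c d e f d = c ∧ pairMove p q c d e f e = f ∧ pairMove p q c d e f f = e := by
  have hne1 := hdes.quadLine_ne h.1
  have hne2 := hdes.quadLine_ne h.2
  have ne1 := h.3
  have ne2 := h.4
  have ne3 := h.5
  have ne4 := h.6
  simp only [pairMove, Perm.mul_apply, swap_apply_def]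
  grind

end LinePair

lemma pairMove_apply_of_ne {p q c d e f z : Ω} (hp : z ≠ p) (hq : z ≠ q) (hc : z ≠ c)
    (hd : z ≠ d) (he : z ≠ e) (hf : z ≠ f) : pairMove p q c d e f z = z := by
  simp only [pairMove, Perm.mul_apply, swap_apply_of_ne_of_ne, *, ne_eq, not_false_eq_true]

lemma LinePair.pairMove_apply_eq_swap {B : Finset (Finset Ω)} {p q c d e f : Ω}
    (hdes : IsTwoDesign B 2) (h : LinePair B p q c d e f) {z : Ω}
    (hp : z ≠ p) (hq : z ≠ q) (hc : z ≠ c) (hd : z ≠ d) :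
    pairMove p q c d e f z = swap e f z ∧
      swap e f z ≠ p ∧ swap e f z ≠ q ∧ swap e f z ≠ c ∧ swap e f z ≠ d := by
  have hne2 := hdes.quadLine_ne h.2
  have ne1 := h.3
  have ne2 := h.4
  have ne3 := h.5
  have ne4 := h.6
  simp only [pairMove, Perm.mul_apply, swap_apply_def]
  grind

lemma pairMove_comm (p q c d e f : Ω) : pairMove p q c d e f = pairMove q p c d e f := by
  rw [pairMove, pairMove, swap_comm p q]

/-- The closed move sequence `[x,a,b,x]` around a line `{x,a,b,c}` is a product of three
transpositions. -/
lemma pairMove_collinear {B : Finset (Finset Ω)} (hdes : IsTwoDesign B 2)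
    {x a b c d₁ d₂ e₁ e₂ f₁ f₂ : Ω} (hd : LinePair B x a b c d₁ d₂)
    (he : LinePair B a b x c e₁ e₂) (hf : LinePair B x b a c f₁ f₂) (z : Ω) :
    pairMove x b a c f₁ f₂ (pairMove a b x c e₁ e₂ (pairMove x a b c d₁ d₂ z)) =
      swap f₁ f₂ (swap e₁ e₂ (swap d₁ d₂ z)) := by
  have hD := hd.pairMove_apply hdes
  have hE := he.pairMove_apply hdes
  have hF := hf.pairMove_apply hdes
  have hd' := hdes.quadLine_ne hd.2
  have he' := hdes.quadLine_ne he.2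
  have hf' := hdes.quadLine_ne hf.2
  by_cases hzx : z = x
  · subst hzx
    rw [hD.1, hE.1, hF.2.1, swap_apply_of_ne_of_ne hd'.2.1 hd'.2.2.1,
      swap_apply_of_ne_of_ne he.3 he.4, swap_apply_of_ne_of_ne hf'.2.1 hf'.2.2.1]
  by_cases hza : z = a
  · subst hza
    rw [hD.2.1, hE.2.2.1, hF.2.2.2.1, swap_apply_of_ne_of_ne hd'.2.2.2.1 hd'.2.2.2.2.1,
      swap_apply_of_ne_of_ne he'.2.1 he'.2.2.1, swap_apply_of_ne_of_ne hf.3 hf.4]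
  by_cases hzb : z = b
  · subst hzb
    rw [hD.2.2.1, hE.2.2.2.1, hF.1, swap_apply_of_ne_of_ne hd.3 hd.4,
      swap_apply_of_ne_of_ne he'.2.2.2.1 he'.2.2.2.2.1,
      swap_apply_of_ne_of_ne hf'.2.2.2.1 hf'.2.2.2.2.1]
  by_cases hzc : z = c
  · subst hzc
    rw [hD.2.2.2.1, hE.2.1, hF.2.2.1, swap_apply_of_ne_of_ne hd.5 hd.6,
      swap_apply_of_ne_of_ne he.5 he.6, swap_apply_of_ne_of_ne hf.5 hf.6]
  obtain ⟨h1, h2, h3, h4, h5⟩ := hd.pairMove_apply_eq_swap hdes hzx hza hzb hzc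
  rw [h1]
  obtain ⟨h1, h2, h3, h4, h5⟩ := he.pairMove_apply_eq_swap hdes h3 h4 h2 h5
  rw [h1]
  exact (hf.pairMove_apply_eq_swap hdes h4 h3 h2 h5).1

/-- A colouring of the points whose colour classes are `{x}` and sets of size `k`, and which is
respected by the closed move sequences `[x,a,b,x]`. -/
structure HoleColoring {β : Type*} (B : Finset (Finset Ω)) (x : Ω) (k : ℕ) (col : Ω → β) :
    Prop where
  hole : ∀ z, col z = col x → z = x
  card : ∀ u, u ≠ x → {z | col z = col u}.ncard = k
  move : ∀ {a b d₁ d₂ d₃ d₄ e₁ e₂ e₃ e₄ f₁ f₂ f₃ f₄ : Ω},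
    LinePair B x a d₁ d₂ d₃ d₄ → LinePair B a b e₁ e₂ e₃ e₄ → LinePair B x b f₁ f₂ f₃ f₄ →
    ∀ u v, col u = col v ↔
      col (pairMove x b f₁ f₂ f₃ f₄ (pairMove a b e₁ e₂ e₃ e₄ (pairMove x a d₁ d₂ d₃ d₄ u))) =
      col (pairMove x b f₁ f₂ f₃ f₄ (pairMove a b e₁ e₂ e₃ e₄ (pairMove x a d₁ d₂ d₃ d₄ v)))

lemma IsHoleBlockSystem.holeColoring {B : Finset (Finset Ω)} (hdes : IsTwoDesign B 2)
    (hss : HGSupersimple B) {x : Ω} {P : Finset (Finset Ω)} {k ℓ : ℕ}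
    (hP : IsHoleBlockSystem B x P k ℓ) :
    HoleColoring B x k fun z => P.filter (z ∈ ·) := by
  obtain ⟨-, -, -, hk, hex, hx, hinv⟩ := hP
  have hcol : ∀ {u v : Ω} {Δ : Finset Ω}, Δ ∈ P → u ∈ Δ →
      (P.filter (v ∈ ·) = P.filter (u ∈ ·) ↔ v ∈ Δ) := by
    intro u v Δ hΔ hu
    have hux : u ≠ x := fun h => hx Δ hΔ (h ▸ hu)
    constructor
    · intro h
      have : Δ ∈ P.filter (v ∈ ·) := h ▸ Finset.mem_filter.2 ⟨hΔ, hu⟩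
      exact (Finset.mem_filter.1 this).2
    · intro hv
      have hvx : v ≠ x := fun h => hx Δ hΔ (h ▸ hv)
      ext Δ'
      simp only [Finset.mem_filter, and_congr_right_iff]
      intro hΔ'
      exact ⟨fun h => (hex v hvx).unique ⟨hΔ', h⟩ ⟨hΔ, hv⟩ ▸ hu,
        fun h => (hex u hux).unique ⟨hΔ', h⟩ ⟨hΔ, hu⟩ ▸ hv⟩
  have hole : ∀ z, P.filter (z ∈ ·) = P.filter (x ∈ ·) → z = x := by
    intro z hz
    by_contra hzx
    obtain ⟨Δ, ⟨hΔ, hzΔ⟩, -⟩ := hex z hzx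
    exact hx Δ hΔ ((hcol hΔ hzΔ).1 hz.symm)
  refine ⟨hole, fun u hu => ?_, ?_⟩
  · obtain ⟨Δ, ⟨hΔ, huΔ⟩, -⟩ := hex u hu
    rw [← hk Δ hΔ, ← Set.ncard_coe_finset]
    congr 1
    ext z
    exact hcol hΔ huΔ
  · intro a b d₁ d₂ d₃ d₄ e₁ e₂ e₃ e₄ f₁ f₂ f₃ f₄ hd he hf
    set g : Equiv.Perm Ω :=
      pairMove x b f₁ f₂ f₃ f₄ * pairMove a b e₁ e₂ e₃ e₄ * pairMove x a d₁ d₂ d₃ d₄ with hg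
    have hgx : g x = x := by
      simp only [hg, Perm.mul_apply]
      rw [(hd.pairMove_apply hdes).1, (he.pairMove_apply hdes).1, (hf.pairMove_apply hdes).2.1]
    have hgmem : g ∈ holeStab B x :=
      ⟨[x, a, b, x], rfl, rfl, _, _, hd.isElemMove hdes hss, ⟨_, _, he.isElemMove hdes hss,
        ⟨_, _, hf.swap_points.isElemMove hdes hss, rfl, rfl⟩, rfl⟩, by
          rw [hg, pairMove_comm x b, one_mul]⟩
    intro u v
    change _ ↔ P.filter (g u ∈ ·) = P.filter (g v ∈ ·)
    by_cases hv : v = x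
    · subst hv
      constructor
      · intro h
        rw [hole u h]
      · intro h
        rw [hgx] at h
        rw [g.injective ((hole _ h).trans hgx.symm)]
    · obtain ⟨Δ, ⟨hΔ, hvΔ⟩, -⟩ := hex v hv
      rw [hcol hΔ hvΔ, hcol (hinv g hgmem Δ hΔ) (Finset.mem_image_of_mem g hvΔ),
        g.injective.mem_finset_image]

lemma HGSupersimple.pairs_ne {B : Finset (Finset Ω)} (hdes : IsTwoDesign B 2)
    (hss : HGSupersimple B) {p q r c d e f : Ω} (h : QuadLine B p q c d)
    (h' : QuadLine B p r e f) (hqr : q ≠ r) : ¬(c = e ∧ d = f) ∧ ¬(c = f ∧ d = e) := by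
  constructor <;> rintro ⟨rfl, rfl⟩
  · exact hqr (hss.quadLine_unique hdes h.swap_mid.swap_last.swap_mid
      h'.swap_mid.swap_last.swap_mid)
  · exact hqr (hss.quadLine_unique hdes h.swap_mid.swap_last.swap_mid
      h'.swap_last.swap_mid.swap_last.swap_mid)

lemma three_swaps_fixing_colors {α β : Type*} [DecidableEq α] {col : α → β}
    {d₁ d₂ e₁ e₂ f₁ f₂ : α} (hd : d₁ ≠ d₂) (he : e₁ ≠ e₂) (hf : f₁ ≠ f₂)
    (hde : ¬(d₁ = e₁ ∧ d₂ = e₂) ∧ ¬(d₁ = e₂ ∧ d₂ = e₁))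
    (hdf : ¬(d₁ = f₁ ∧ d₂ = f₂) ∧ ¬(d₁ = f₂ ∧ d₂ = f₁))
    (hef : ¬(e₁ = f₁ ∧ e₂ = f₂) ∧ ¬(e₁ = f₂ ∧ e₂ = f₁))
    (h : ∀ z, col (swap f₁ f₂ (swap e₁ e₂ (swap d₁ d₂ z))) = col z) :
    (col d₁ = col d₂ ∧ col e₁ = col e₂ ∧ col f₁ = col f₂) ∨
    (col e₁ = col e₂ ∧
      ((d₁ = f₁ ∧ (d₂ = e₁ ∧ f₂ = e₂ ∨ d₂ = e₂ ∧ f₂ = e₁)) ∨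
      (d₁ = f₂ ∧ (d₂ = e₁ ∧ f₁ = e₂ ∨ d₂ = e₂ ∧ f₁ = e₁)) ∨
      (d₂ = f₁ ∧ (d₁ = e₁ ∧ f₂ = e₂ ∨ d₁ = e₂ ∧ f₂ = e₁)) ∨
      (d₂ = f₂ ∧ (d₁ = e₁ ∧ f₁ = e₂ ∨ d₁ = e₂ ∧ f₁ = e₁)))) := by
  have h1 := h d₁
  have h2 := h d₂
  have h3 := h e₁
  have h4 := h e₂
  have h5 := h f₁
  have h6 := h f₂
  clear h
  simp only [swap_apply_def] at h1 h2 h3 h4 h5 h6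
  by_cases a1 : d₁ = e₁ <;> by_cases a2 : d₁ = e₂ <;> by_cases a3 : d₂ = e₁ <;>
    by_cases a4 : d₂ = e₂ <;> grind

namespace HoleColoring

variable {β : Type*} {B : Finset (Finset Ω)} {x : Ω} {k : ℕ} {col : Ω → β}

lemma collinear_cases (hdes : IsTwoDesign B 2) (hss : HGSupersimple B)
    (hc : HoleColoring B x k col) (hk : 3 ≤ k) {a b c d₁ d₂ e₁ e₂ f₁ f₂ : Ω}
    (hd : LinePair B x a b c d₁ d₂) (he : LinePair B a b x c e₁ e₂)
    (hf : LinePair B x b a c f₁ f₂) :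
    (col d₁ = col d₂ ∧ col e₁ = col e₂ ∧ col f₁ = col f₂) ∨
    (col e₁ = col e₂ ∧
      ((d₁ = f₁ ∧ (d₂ = e₁ ∧ f₂ = e₂ ∨ d₂ = e₂ ∧ f₂ = e₁)) ∨
      (d₁ = f₂ ∧ (d₂ = e₁ ∧ f₁ = e₂ ∨ d₂ = e₂ ∧ f₁ = e₁)) ∨
      (d₂ = f₁ ∧ (d₁ = e₁ ∧ f₂ = e₂ ∨ d₁ = e₂ ∧ f₂ = e₁)) ∨
      (d₂ = f₂ ∧ (d₁ = e₁ ∧ f₁ = e₂ ∨ d₁ = e₂ ∧ f₁ = e₁)))) ∨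
    (k = 3 ∧ [d₁, d₂, e₁, e₂, f₁, f₂].Nodup ∧
      col d₁ ≠ col d₂ ∧ col e₁ ≠ col e₂ ∧ col f₁ ≠ col f₂ ∧
      ∀ z, z ∈ [d₁, d₂, e₁, e₂, f₁, f₂] ↔ col z = col d₁ ∨ col z = col d₂) := by
  have hl := hdes.quadLine_ne hd.1
  have hd' := hdes.quadLine_ne hd.2
  have he' := hdes.quadLine_ne he.2
  have hf' := hdes.quadLine_ne hf.2
  have hmove : ∀ u v, col u = col v ↔ col (swap f₁ f₂ (swap e₁ e₂ (swap d₁ d₂ u))) =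
      col (swap f₁ f₂ (swap e₁ e₂ (swap d₁ d₂ v))) := fun u v => by
    have := hc.move hd he hf u v
    rwa [pairMove_collinear hdes hd he hf, pairMove_collinear hdes hd he hf] at this
  by_cases hfix : ∀ z, col (swap f₁ f₂ (swap e₁ e₂ (swap d₁ d₂ z))) = col z
  · refine (three_swaps_fixing_colors hd'.2.2.2.2.2 he'.2.2.2.2.2 hf'.2.2.2.2.2 ?_ ?_ ?_ hfix).imp
      id Or.inl
    · exact hss.pairs_ne hdes hd.2.swap_first he.2 hl.2.1
    · exact hss.pairs_ne hdes hd.2 hf.2 hl.2.2.2.1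
    · exact hss.pairs_ne hdes he.2.swap_first hf.2.swap_first hl.1.symm
  · right; right
    push Not at hfix
    obtain ⟨u, hu⟩ := hfix
    set g : Equiv.Perm Ω := swap f₁ f₂ * swap e₁ e₂ * swap d₁ d₂ with hg
    replace hmove : ∀ u v, col u = col v ↔ col (g u) = col (g v) := hmove
    replace hu : col (g u) ≠ col u := hu
    have hgx : g x = x := by
      simp only [hg, Perm.mul_apply]
      rw [swap_apply_of_ne_of_ne hd'.2.1 hd'.2.2.1, swap_apply_of_ne_of_ne he.3 he.4,
        swap_apply_of_ne_of_ne hf'.2.1 hf'.2.2.1]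
    have hux : u ≠ x := by
      rintro rfl
      exact hu (by rw [hgx])
    have hgux : g u ≠ x := fun h => hux (g.injective (h.trans hgx.symm))
    set S : Set Ω := {z | col z = col u} ∪ {z | col z = col (g u)} with hS
    have hmoved : ∀ z ∈ S, col (g z) ≠ col z := by
      rintro z (hz | hz) h
      · exact hu (by rw [← (hmove z u).1 hz, h]; exact hz)
      · exact hu (hz.symm.trans ((hmove z u).2 (h.trans hz)))
    have hsub : S ⊆ ([d₁, d₂, e₁, e₂, f₁, f₂].toFinset : Set Ω) := by
      intro z hz
      by_contra hz'
      simp only [List.coe_toFinset, List.mem_cons, List.not_mem_nil, or_false, Set.mem_ofPred_eq,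
        not_or] at hz'
      refine hmoved z hz ?_
      simp only [hg, Perm.mul_apply]
      rw [swap_apply_of_ne_of_ne hz'.1 hz'.2.1, swap_apply_of_ne_of_ne hz'.2.2.1 hz'.2.2.2.1,
        swap_apply_of_ne_of_ne hz'.2.2.2.2.1 hz'.2.2.2.2.2]
    have hScard : S.ncard = k + k := by
      rw [hS, Set.ncard_union_eq, hc.card u hux, hc.card _ hgux]
      exact Set.disjoint_left.2 fun z h1 h2 => hu (h2.symm.trans h1)
    have hle := Set.ncard_le_ncard hsub
    have hlen := List.toFinset_card_le [d₁, d₂, e₁, e₂, f₁, f₂]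
    rw [Set.ncard_coe_finset] at hle
    simp only [List.length_cons, List.length_nil] at hlen
    have hnd : [d₁, d₂, e₁, e₂, f₁, f₂].Nodup := by
      rw [← Multiset.coe_nodup, ← Multiset.toFinset_card_eq_card_iff_nodup]
      change ([d₁, d₂, e₁, e₂, f₁, f₂].toFinset).card = 6
      omega
    have hSeq : S = ([d₁, d₂, e₁, e₂, f₁, f₂].toFinset : Set Ω) := by
      refine Set.eq_of_subset_of_ncard_le hsub ?_
      rw [Set.ncard_coe_finset]
      omega
    have hmem : ∀ z, z ∈ [d₁, d₂, e₁, e₂, f₁, f₂] ↔ col z = col u ∨ col z = col (g u) := by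
      intro z
      rw [← List.mem_toFinset, ← Finset.mem_coe, ← hSeq]
      rfl
    have hne : ∀ z ∈ [d₁, d₂, e₁, e₂, f₁, f₂], col (g z) ≠ col z := fun z hz =>
      hmoved z (by rw [hSeq]; simpa using hz)
    have hgd : g d₁ = d₂ ∧ g e₁ = e₂ ∧ g f₁ = f₂ := by
      simp only [List.nodup_cons, List.mem_cons, List.not_mem_nil, not_or] at hnd
      simp only [hg, Perm.mul_apply, swap_apply_def]
      grind
    have h1 := hne d₁ (by simp)
    have h2 := hne e₁ (by simp)
    have h3 := hne f₁ (by simp)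
    rw [hgd.1] at h1
    rw [hgd.2.1] at h2
    rw [hgd.2.2] at h3
    have h4 := (hmem d₁).1 (by simp)
    have h5 := (hmem d₂).1 (by simp)
    refine ⟨by omega, hnd, h1.symm, h2.symm, h3.symm, fun z => ?_⟩
    rw [hmem]
    grind

end HoleColoring

lemma HGSupersimple.three_lines_through {B : Finset (Finset Ω)} (hdes : IsTwoDesign B 2)
    (hss : HGSupersimple B) {x a b c p u v w : Ω} (h : QuadLine B x a b c) (hpa : p ≠ a)
    (hpb : p ≠ b) (hpc : p ≠ c) (hu : QuadLine B x a p u) (hv : QuadLine B x b p v)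
    (hw : QuadLine B x c p w) : False := by
  have hne := hdes.quadLine_ne h
  obtain ⟨e, f, hef⟩ := exists_linePair hdes hss hu.swap_mid
  have hv' := hef.line_cases hdes hss hv.swap_mid
  have hw' := hef.line_cases hdes hss hw.swap_mid
  have hub : u ≠ b := by
    rintro rfl
    exact hpc (hss.quadLine_unique hdes hu.swap_last h)
  have huc : u ≠ c := by
    rintro rfl
    exact hpb (hss.quadLine_unique hdes hu.swap_last h.swap_last)
  have hvc : v ≠ c := by
    rintro rfl
    exact hpa (hss.quadLine_unique hdes hv.swap_last h.swap_mid.swap_last)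
  grind

namespace HoleColoring

variable {β : Type*} {B : Finset (Finset Ω)} {x : Ω} {k : ℕ} {col : Ω → β}

lemma corner_of_four_le (hdes : IsTwoDesign B 2) (hss : HGSupersimple B)
    (hc : HoleColoring B x k col) (hk : 4 ≤ k) {a b c d₁ d₂ : Ω}
    (hd : LinePair B x a b c d₁ d₂) : col d₁ = col d₂ := by
  obtain ⟨e₁, e₂, hab⟩ := exists_linePair hdes hss (p := a) (q := b) (c := x) (d := c)
    hd.1.swap_first.swap_mid
  obtain ⟨f₁, f₂, hxb⟩ := exists_linePair hdes hss (p := x) (q := b) (c := a) (d := c)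
    hd.1.swap_mid
  obtain ⟨p₁, p₂, hac⟩ := exists_linePair hdes hss (p := a) (q := c) (c := x) (d := b)
    hd.1.swap_last.swap_first.swap_mid
  obtain ⟨h₁, h₂, hxc⟩ := exists_linePair hdes hss (p := x) (q := c) (c := a) (d := b)
    hd.1.swap_last.swap_mid
  obtain ⟨r₁, r₂, hbc⟩ := exists_linePair hdes hss (p := b) (q := c) (c := x) (d := a)
    hd.1.swap_mid.swap_last.swap_first.swap_mid
  have c1 := hc.collinear_cases hdes hss (by omega) hd hab hxb
  have c2 := hc.collinear_cases hdes hss (by omega) hd.swap_fst hac hxc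
  have c3 := hc.collinear_cases hdes hss (by omega) hxb.swap_fst hbc hxc.swap_fst
  have hk3 : k ≠ 3 := by omega
  simp only [hk3, false_and, or_false] at c1 c2 c3
  have hd' := hdes.quadLine_ne hd.2
  have hp' := hdes.quadLine_ne hac.2
  have hno : ∀ {p u v w}, QuadLine B x a p u → QuadLine B x b p v → QuadLine B x c p w →
      p ≠ b → p ≠ c → False := fun {p u v w} h1 h2 h3 hb hc =>
    hss.three_lines_through hdes hd.1 (hdes.quadLine_ne h1).2.2.2.1.symm hb hc h1 h2 h3
  have n1 : ¬((d₁ = f₁ ∨ d₁ = f₂) ∧ (d₁ = h₁ ∨ d₁ = h₂)) := by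
    rintro ⟨rfl | rfl, rfl | rfl⟩
    exacts [hno hd.2 hxb.2 hxc.2 hd.3.symm hd.5.symm,
      hno hd.2 hxb.2 hxc.2.swap_last hd.3.symm hd.5.symm,
      hno hd.2 hxb.2.swap_last hxc.2 hd.3.symm hd.5.symm,
      hno hd.2 hxb.2.swap_last hxc.2.swap_last hd.3.symm hd.5.symm]
  have n2 : ¬((d₂ = f₁ ∨ d₂ = f₂) ∧ (d₂ = h₁ ∨ d₂ = h₂)) := by
    rintro ⟨rfl | rfl, rfl | rfl⟩
    exacts [hno hd.2.swap_last hxb.2 hxc.2 hd.4.symm hd.6.symm,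
      hno hd.2.swap_last hxb.2 hxc.2.swap_last hd.4.symm hd.6.symm,
      hno hd.2.swap_last hxb.2.swap_last hxc.2 hd.4.symm hd.6.symm,
      hno hd.2.swap_last hxb.2.swap_last hxc.2.swap_last hd.4.symm hd.6.symm]
  by_contra hcon
  rcases c1 with c1 | ⟨hc1, c1⟩
  · exact hcon c1.1
  rcases c2 with c2 | ⟨hc2, c2⟩
  · exact hcon c2.1
  rcases c3 with ⟨c3, -, -⟩ | ⟨-, c3⟩
  · clear c2 hc2 n1 n2
    grind
  · rcases c1 with ⟨h1, h2 | h2⟩ | ⟨h1, h2 | h2⟩ | ⟨h1, h2 | h2⟩ | ⟨h1, h2 | h2⟩ <;>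
    rcases c2 with ⟨h3, h4 | h4⟩ | ⟨h3, h4 | h4⟩ | ⟨h3, h4 | h4⟩ | ⟨h3, h4 | h4⟩ <;>
    grind

lemma no_four (hc : HoleColoring B x 3 col) {p q r s : Ω} (h : [p, q, r, s].Nodup)
    (hq : col q = col p) (hr : col r = col p) (hs : col s = col p) : False := by
  by_cases hp : p = x
  · subst hp
    simp [hc.hole q hq] at h
  · have hsub : (([p, q, r, s].toFinset : Finset Ω) : Set Ω) ⊆ {z | col z = col p} := by
      intro z hz
      simp only [List.coe_toFinset, List.mem_cons, List.not_mem_nil, or_false,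
        Set.mem_ofPred_eq] at hz
      rcases hz with rfl | rfl | rfl | rfl
      exacts [rfl, hq, hr, hs]
    have hle := Set.ncard_le_ncard hsub
    rw [hc.card p hp, Set.ncard_coe_finset, List.toFinset_card_of_nodup h] at hle
    simp at hle

lemma no_triangle (hdes : IsTwoDesign B 2) (hss : HGSupersimple B)
    (hc : HoleColoring B x 3 col) {a b c d₁ d₂ d₃ : Ω}
    (hd : LinePair B x a b c d₁ d₂) (hf : LinePair B x b a c d₁ d₃) : False := by
  have hl := hdes.quadLine_ne hd.1
  have hd' := hdes.quadLine_ne hd.2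
  have hf' := hdes.quadLine_ne hf.2
  have h23 : d₂ ≠ d₃ := by
    rintro rfl
    exact hl.2.2.2.1 (hss.quadLine_unique hdes hd.2.swap_mid.swap_last.swap_mid
      hf.2.swap_mid.swap_last.swap_mid)
  obtain ⟨e₁, e₂, hab⟩ := exists_linePair hdes hss (p := a) (q := b) (c := x) (d := c)
    hd.1.swap_first.swap_mid
  obtain ⟨g₁, g₂, hg⟩ := exists_linePair hdes hss (p := a) (q := d₁) (c := x) (d := d₂)
    hd.2.swap_first.swap_mid
  obtain ⟨k₁, k₂, hk⟩ := exists_linePair hdes hss (p := b) (q := d₁) (c := x) (d := d₃)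
    hf.2.swap_first.swap_mid
  obtain ⟨m₁, m₂, hm⟩ := exists_linePair hdes hss (p := x) (q := c) (c := a) (d := b)
    hd.1.swap_last.swap_mid
  have c1 := hc.collinear_cases hdes hss le_rfl hd hab hf
  have c2 := hc.collinear_cases hdes hss le_rfl hd.swap_lines hg
    ⟨hd.2.swap_mid, hf.2.swap_mid, hl.2.2.2.1, hf.4, hd.4.symm, h23⟩
  have c3 := hc.collinear_cases hdes hss le_rfl hf.swap_lines hk
    ⟨hf.2.swap_mid, hd.2.swap_mid, hl.2.2.2.1.symm, hd.4, hf.4.symm, h23.symm⟩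
  have hcd3 : col c = col d₃ := by
    have := hd.5; have := hd.6; have := hf.6
    simp only [List.nodup_cons, List.mem_cons, List.not_mem_nil, not_or] at c2
    clear c1 c3
    grind
  have hcd2 : col c = col d₂ := by
    have := hd.5; have := hd.6; have := hf.6
    simp only [List.nodup_cons, List.mem_cons, List.not_mem_nil, not_or] at c3
    clear c1 c2
    grind
  have h1 : col d₁ ≠ col c := fun h => by
    refine hc.no_four (p := c) (q := d₁) (r := d₂) (s := d₃) ?_ h hcd2.symm hcd3.symm
    have := hd.5; have := hd.6; have := hf.6
    simp only [List.nodup_cons, List.mem_cons, List.not_mem_nil, not_or]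
    grind
  have hbc : col b ≠ col c := fun h => by
    refine hc.no_four (p := c) (q := b) (r := d₂) (s := d₃) ?_ h hcd2.symm hcd3.symm
    have := hd.6; have := hf.6; have := hd.4
    simp only [List.nodup_cons, List.mem_cons, List.not_mem_nil, not_or]
    grind
  have hg' : QuadLine B a d₁ c d₃ := by
    have hgg := hg.2
    have hgg' := hg.2.swap_last
    simp only [List.nodup_cons, List.mem_cons, List.not_mem_nil, not_or] at c2
    have := hd.5; have := hd.6; have := hf.6
    clear c1 c3
    grind
  have c4 := hc.collinear_cases hdes hss le_rfl hd.swap_fst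
    (e₁ := d₁) (e₂ := d₃) ⟨hd.1.swap_last.swap_first.swap_mid, hg'.swap_mid, hd'.2.1, hf'.2.2.1,
      hd.3, hf'.2.2.2.2.1⟩ hm
  simp only [List.nodup_cons, List.mem_cons, List.not_mem_nil, not_or] at c4
  clear c1 c2 c3
  grind

end HoleColoring

/-- A line `{x, a, b, c}` together with six points, two triples of equal color, which make up
the second lines through the pairs of its points. -/
structure HexLine {β : Type*} (B : Finset (Finset Ω)) (x : Ω) (col : Ω → β)
    (a b c a₁ a₂ b₁ b₂ c₁ c₂ : Ω) : Prop where
  xa : LinePair B x a b c a₁ a₂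
  xb : LinePair B x b c a b₁ b₂
  xc : LinePair B x c a b c₁ c₂
  ab : LinePair B a b c x c₁ c₂
  bc : LinePair B b c a x a₁ a₂
  ca : LinePair B c a b x b₁ b₂
  nodup : [a₁, a₂, b₁, b₂, c₁, c₂].Nodup
  ne : col a₁ ≠ col a₂
  fst : ∀ z, col z = col a₁ ↔ z = a₁ ∨ z = b₁ ∨ z = c₁
  snd : ∀ z, col z = col a₂ ↔ z = a₂ ∨ z = b₂ ∨ z = c₂

lemma pairMove_apply_cases (p q c d e f z : Ω) :
    z = p ∨ z = q ∨ z = c ∨ z = d ∨ z = e ∨ z = f ∨ pairMove p q c d e f z = z := by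
  by_contra! h
  obtain ⟨hp, hq, hc, hd, he, hf, h⟩ := h
  exact h (pairMove_apply_of_ne hp hq hc hd he hf)

lemma LinePair.pairMove_self {B : Finset (Finset Ω)} (hdes : IsTwoDesign B 2)
    {p q c d e f : Ω} (h : LinePair B p q c d e f) (z : Ω) :
    pairMove p q c d e f (pairMove p q c d e f z) = z := by
  have hM := h.pairMove_apply hdes
  obtain rfl | rfl | rfl | rfl | rfl | rfl | hz := pairMove_apply_cases p q c d e f z <;> grind

lemma LinePair.col_pairMove {β : Type*} {col : Ω → β} {B : Finset (Finset Ω)}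
    (hdes : IsTwoDesign B 2) {p q c d e f : Ω} (h : LinePair B p q c d e f)
    (hcd : col c = col d) (hef : col e = col f) {z : Ω} (hp : z ≠ p) (hq : z ≠ q) :
    col (pairMove p q c d e f z) = col z := by
  have hM := h.pairMove_apply hdes
  obtain rfl | rfl | rfl | rfl | rfl | rfl | hz := pairMove_apply_cases p q c d e f z <;> grind

namespace HoleColoring

variable {β : Type*} {B : Finset (Finset Ω)} {x : Ω} {k : ℕ} {col : Ω → β}

lemma line_mono (hdes : IsTwoDesign B 2) (hss : HGSupersimple B)
    (hcorner : ∀ {a b c d₁ d₂ : Ω}, LinePair B x a b c d₁ d₂ → col d₁ = col d₂)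
    {a p q : Ω} (h : QuadLine B x a p q) : col a = col p := by
  obtain ⟨r, s, hrs⟩ := exists_linePair hdes hss h.swap_last.swap_mid
  exact hcorner hrs.swap_lines

/-- A block system with blocks of size at least four is trivial. -/
lemma col_eq_of_four_le (hdes : IsTwoDesign B 2) (hss : HGSupersimple B)
    (hc : HoleColoring B x k col) (hk : 4 ≤ k) {a b : Ω} (ha : a ≠ x) (hb : b ≠ x) :
    col a = col b := by
  have hmono : ∀ {a p q : Ω}, QuadLine B x a p q → col a = col p := fun h =>
    line_mono hdes hss (hc.corner_of_four_le hdes hss hk) h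
  by_contra hab
  obtain ⟨a₁, a₂, a₃, a₄, hD⟩ := exists_linePair_of_ne hdes hss ha.symm
  obtain ⟨e₁, e₂, e₃, e₄, hE⟩ := exists_linePair_of_ne hdes hss fun h : a = b => hab (h ▸ rfl)
  obtain ⟨b₁, b₂, b₃, b₄, hF⟩ := exists_linePair_of_ne hdes hss hb.symm
  have hmem : ∀ {e f : Ω}, QuadLine B a b e f → e ≠ x := by
    rintro e f h rfl
    exact hab (hmono h.swap_mid.swap_first)
  have hE₁ := hmem hE.1
  have hE₂ := hmem hE.1.swap_last
  have hE₃ := hmem hE.2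
  have hE₄ := hmem hE.2.swap_last
  have hDa := hD.pairMove_apply hdes
  have hEa := hE.pairMove_apply hdes
  have hFa := hF.pairMove_apply hdes
  have hEx : pairMove a b e₁ e₂ e₃ e₄ x = x :=
    pairMove_apply_of_ne ha.symm hb.symm hE₁.symm hE₂.symm hE₃.symm hE₄.symm
  have hD₁ := hmono hD.1.swap_mid.swap_last
  have hD₂ := hmono hD.2.swap_mid.swap_last
  have hF₁ := hmono hF.1.swap_mid.swap_last
  have hF₂ := hmono hF.2.swap_mid.swap_last
  have hEcol : ∀ w, col w = col a → w ≠ a → col (pairMove a b e₁ e₂ e₃ e₄ w) = col b := by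
    intro w hw hwa
    have hwx : w ≠ x := fun h => ha (hc.hole a (hw ▸ h ▸ rfl))
    have h2 := hc.move hD hE hF a (pairMove x a a₁ a₂ a₃ a₄ w)
    rw [hD.pairMove_self hdes, hD.col_pairMove hdes hD₁ hD₂ hwx hwa, hDa.2.1, hEx, hFa.1] at h2
    by_cases hEw : pairMove a b e₁ e₂ e₃ e₄ w = b
    · rw [hEw]
    · have hEwx : pairMove a b e₁ e₂ e₃ e₄ w ≠ x := fun h =>
        hwx ((pairMove a b e₁ e₂ e₃ e₄).injective (h.trans hEx.symm))
      rw [← hF.col_pairMove hdes hF₁ hF₂ hEwx hEw]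
      exact (h2.1 hw.symm).symm
  have hEe := hdes.quadLine_ne hE.1
  have hEe' := hdes.quadLine_ne hE.2
  classical
  obtain ⟨y, hy⟩ : ∃ y, ∀ w, col w = col a → w = e₁ ∨ w = e₂ → w = y := by
    refine ⟨if col e₁ = col a then e₁ else e₂, ?_⟩
    rintro w hw (rfl | rfl)
    · rw [if_pos hw]
    · rw [if_neg fun h => hab ?_]
      rw [← hw, ← hEcol e₁ h hEe.2.1.symm, hEa.2.2.1]
  obtain ⟨z, hz⟩ : ∃ z, ∀ w, col w = col a → w = e₃ ∨ w = e₄ → w = z := by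
    refine ⟨if col e₃ = col a then e₃ else e₄, ?_⟩
    rintro w hw (rfl | rfl)
    · rw [if_pos hw]
    · rw [if_neg fun h => hab ?_]
      rw [← hw, ← hEcol e₃ h hEe'.2.1.symm, hEa.2.2.2.2.1]
  have hsub : {w | col w = col a} ⊆ (({a, y, z} : Finset Ω) : Set Ω) := by
    intro w hw
    replace hw : col w = col a := hw
    simp only [Finset.coe_insert, Finset.coe_singleton, Set.mem_insert_iff, Set.mem_singleton_iff]
    by_contra! hne
    have hEw := hEcol w hw hne.1
    rcases pairMove_apply_cases a b e₁ e₂ e₃ e₄ w with h | h | h | h | h | h | h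
    · exact hne.1 h
    · exact hab (by rw [← hw, h])
    · exact hne.2.1 (hy w hw (Or.inl h))
    · exact hne.2.1 (hy w hw (Or.inr h))
    · exact hne.2.2 (hz w hw (Or.inl h))
    · exact hne.2.2 (hz w hw (Or.inr h))
    · exact hab (by rw [← hw, ← hEw, h])
  have hle := Set.ncard_le_ncard hsub
  rw [hc.card a ha, Set.ncard_coe_finset] at hle
  have := Finset.card_le_three (a := a) (b := y) (c := z)
  omega

lemma exists_corner_ne (hdes : IsTwoDesign B 2) (hss : HGSupersimple B)
    (hc : HoleColoring B x 3 col) {a : Ω} (ha : a ≠ x) :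
    ∃ a b c d₁ d₂, LinePair B x a b c d₁ d₂ ∧ col d₁ ≠ col d₂ := by
  by_contra! hcorner
  have hmono : ∀ {a p q : Ω}, QuadLine B x a p q → col a = col p := fun h =>
    line_mono hdes hss (hcorner _ _ _ _ _) h
  obtain ⟨b, c, d, e, h⟩ := exists_linePair_of_ne hdes hss ha.symm
  have h1 := hdes.quadLine_ne h.1
  have h2 := hdes.quadLine_ne h.2
  refine hc.no_four (p := a) (q := b) (r := c) (s := d) ?_ (hmono h.1).symm
    (hmono h.1.swap_last).symm (hmono h.2).symm
  have := h.3
  have := h.5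
  simp only [List.nodup_cons, List.mem_cons, List.not_mem_nil, not_or]
  tauto

lemma collinear_distinct (hdes : IsTwoDesign B 2) (hss : HGSupersimple B)
    (hc : HoleColoring B x 3 col) {a b c d₁ d₂ e₁ e₂ f₁ f₂ : Ω}
    (hd : LinePair B x a b c d₁ d₂) (he : LinePair B a b x c e₁ e₂)
    (hf : LinePair B x b a c f₁ f₂) (hne : col d₁ ≠ col d₂) :
    [d₁, d₂, e₁, e₂, f₁, f₂].Nodup ∧ col f₁ ≠ col f₂ ∧
      ∀ z, z ∈ [d₁, d₂, e₁, e₂, f₁, f₂] ↔ col z = col d₁ ∨ col z = col d₂ := by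
  rcases hc.collinear_cases hdes hss le_rfl hd he hf with h | ⟨-, h⟩ | h
  · exact absurd h.1 hne
  · exfalso
    rcases h with ⟨rfl, -⟩ | ⟨rfl, -⟩ | ⟨rfl, -⟩ | ⟨rfl, -⟩
    · exact hc.no_triangle hdes hss hd hf
    · exact hc.no_triangle hdes hss hd hf.swap_snd
    · exact hc.no_triangle hdes hss hd.swap_snd hf
    · exact hc.no_triangle hdes hss hd.swap_snd hf.swap_snd
  · exact ⟨h.2.1, h.2.2.2.2.1, h.2.2.2.2.2⟩

end HoleColoring

lemma HexLine.rotate {β : Type*} {B : Finset (Finset Ω)} {x : Ω} {col : Ω → β}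
    {a b c a₁ a₂ b₁ b₂ c₁ c₂ : Ω} (h : HexLine B x col a b c a₁ a₂ b₁ b₂ c₁ c₂) :
    HexLine B x col b c a b₁ b₂ c₁ c₂ a₁ a₂ where
  xa := h.xb
  xb := h.xc
  xc := h.xa
  ab := h.bc
  bc := h.ca
  ca := h.ab
  nodup := by
    have := h.nodup
    simp only [List.nodup_cons, List.mem_cons, List.not_mem_nil, not_or] at this ⊢
    grind
  ne := by
    rw [(h.fst b₁).2 (by simp), (h.snd b₂).2 (by simp)]
    exact h.ne
  fst z := by
    rw [(h.fst b₁).2 (by simp), h.fst]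
    tauto
  snd z := by
    rw [(h.snd b₂).2 (by simp), h.snd]
    tauto

namespace HoleColoring

variable {β : Type*} {B : Finset (Finset Ω)} {x : Ω} {col : Ω → β}

/-- For blocks of size three, every second line with differently colored points extends to a
hexad line. -/
lemma exists_hexLine (hdes : IsTwoDesign B 2) (hss : HGSupersimple B)
    (hc : HoleColoring B x 3 col) {a b c a₁ a₂ : Ω} (ha : LinePair B x a b c a₁ a₂)
    (hne : col a₁ ≠ col a₂) : ∃ b₁ b₂ c₁ c₂, HexLine B x col a b c a₁ a₂ b₁ b₂ c₁ c₂ := by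
  obtain ⟨b₁, b₂, hb⟩ := exists_linePair hdes hss (p := x) (q := b) (c := c) (d := a)
    ha.1.swap_mid.swap_last
  obtain ⟨c₁, c₂, hcc⟩ := exists_linePair hdes hss (p := x) (q := c) (c := a) (d := b)
    ha.1.swap_last.swap_mid
  obtain ⟨p₁, p₂, hp⟩ := exists_linePair hdes hss (p := a) (q := b) (c := c) (d := x)
    ha.1.swap_first.swap_mid.swap_last
  obtain ⟨q₁, q₂, hq⟩ := exists_linePair hdes hss (p := c) (q := a) (c := b) (d := x)
    hcc.1.swap_first.swap_mid.swap_last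
  obtain ⟨r₁, r₂, hr⟩ := exists_linePair hdes hss (p := b) (q := c) (c := a) (d := x)
    hb.1.swap_first.swap_mid.swap_last
  wlog h1 : col b₁ = col a₁ generalizing b₁ b₂
  · obtain ⟨-, hbne, hab⟩ := hc.collinear_distinct hdes hss ha hp.swap_fst hb.swap_fst hne
    have hb₁ := (hab b₁).1 (by simp)
    have hb₂ := (hab b₂).1 (by simp)
    exact this b₂ b₁ hb.swap_snd (by grind)
  wlog h2 : col c₁ = col a₁ generalizing c₁ c₂
  · obtain ⟨-, hcne, hac⟩ :=
      hc.collinear_distinct hdes hss ha.swap_fst hq.swap_points.swap_fst hcc hne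
    have hc₁ := (hac c₁).1 (by simp)
    have hc₂ := (hac c₂).1 (by simp)
    exact this c₂ c₁ hcc.swap_snd (by grind)
  obtain ⟨nab, hbne, hab⟩ := hc.collinear_distinct hdes hss ha hp.swap_fst hb.swap_fst hne
  obtain ⟨nac, hcne, hac⟩ :=
    hc.collinear_distinct hdes hss ha.swap_fst hq.swap_points.swap_fst hcc hne
  obtain ⟨nbc, -, hbc⟩ := hc.collinear_distinct hdes hss hb hr.swap_fst hcc.swap_fst hbne
  have hb₂ : col b₂ = col a₂ := by
    have := (hab b₂).1 (by simp)
    grind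
  have hc₂ : col c₂ = col a₂ := by
    have := (hac c₂).1 (by simp)
    grind
  have hmem : ∀ z, z ∈ [a₁, a₂, q₁, q₂, c₁, c₂] ↔ z ∈ [a₁, a₂, p₁, p₂, b₁, b₂] := fun z =>
    (hac z).trans (hab z).symm
  have hmem' : ∀ z, z ∈ [b₁, b₂, r₁, r₂, c₁, c₂] ↔ z ∈ [a₁, a₂, p₁, p₂, b₁, b₂] := fun z => by
    rw [hbc, hab, h1, hb₂]
  simp only [List.nodup_cons, List.mem_cons, List.not_mem_nil, not_or] at nab nac nbc
  simp only [List.mem_cons, List.not_mem_nil, or_false] at hmem hmem'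
  have hpc : p₁ = c₁ ∧ p₂ = c₂ ∨ p₁ = c₂ ∧ p₂ = c₁ := by
    have m₁ := hmem' c₁
    have m₂ := hmem' c₂
    clear hmem hmem' hab hac hbc
    grind
  have hqb : q₁ = b₁ ∧ q₂ = b₂ ∨ q₁ = b₂ ∧ q₂ = b₁ := by
    have m₁ := hmem b₁
    have m₂ := hmem b₂
    clear hmem hmem' hab hac hbc
    grind
  have hra : r₁ = a₁ ∧ r₂ = a₂ ∨ r₁ = a₂ ∧ r₂ = a₁ := by
    have m₁ := hmem' a₁
    have m₂ := hmem' a₂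
    clear hmem hmem' hab hac hbc
    grind
  have hsix : ∀ z, z = a₁ ∨ z = a₂ ∨ z = b₁ ∨ z = b₂ ∨ z = c₁ ∨ z = c₂ ↔
      col z = col a₁ ∨ col z = col a₂ := by
    intro z
    rw [← hac]
    simp only [List.mem_cons, List.not_mem_nil, or_false]
    clear hmem hmem' hab hac hbc hpc hra
    grind
  refine ⟨b₁, b₂, c₁, c₂, ⟨ha, hb, hcc, ?_, ?_, ?_, ?_, hne, fun z => ?_, fun z => ?_⟩⟩
  · rcases hpc with ⟨rfl, rfl⟩ | ⟨rfl, rfl⟩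
    exacts [hp, hp.swap_snd]
  · rcases hra with ⟨rfl, rfl⟩ | ⟨rfl, rfl⟩
    exacts [hr, hr.swap_snd]
  · rcases hqb with ⟨rfl, rfl⟩ | ⟨rfl, rfl⟩
    exacts [hq, hq.swap_snd]
  · simp only [List.nodup_cons, List.mem_cons, List.not_mem_nil, not_or]
    clear hmem hmem' hab hac hbc hsix
    grind
  · have := hsix z
    clear hmem hmem' hab hac hbc hsix nab nac nbc hpc hqb hra
    grind
  · have := hsix z
    clear hmem hmem' hab hac hbc hsix nab nac nbc hpc hqb hra
    grind

end HoleColoring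

lemma pairMove_apply_eq_or {p q c d e f z : Ω} (hp : z ≠ p) (hq : z ≠ q) (hc : z ≠ c)
    (hd : z ≠ d) : z = e ∨ z = f ∨ pairMove p q c d e f z = z := by
  have := pairMove_apply_cases p q c d e f z
  tauto

namespace HexLine

variable {β : Type*} {B : Finset (Finset Ω)} {x : Ω} {col : Ω → β}
  {a b c a₁ a₂ b₁ b₂ c₁ c₂ : Ω}

lemma not_quadLine (hdes : IsTwoDesign B 2) (hss : HGSupersimple B)
    (h : HexLine B x col a b c a₁ a₂ b₁ b₂ c₁ c₂) (z : Ω) : ¬ QuadLine B x a b₁ z := by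
  intro hz
  have hn := h.nodup
  simp only [List.nodup_cons, List.mem_cons, List.not_mem_nil, not_or] at hn
  have hb := hdes.quadLine_ne h.xb.2
  have hcb := h.xb.3
  rcases h.xa.line_cases hdes hss hz with h | h | h | h <;> grind

lemma exists_linePairs (hdes : IsTwoDesign B 2) (hss : HGSupersimple B)
    (h : HexLine B x col a b c a₁ a₂ b₁ b₂ c₁ c₂) :
    ∃ e e' f f', LinePair B a b₁ c b₂ e e' ∧ LinePair B x b₁ b b₂ f f' ∧
      e ≠ x ∧ e' ≠ x ∧ f ≠ a ∧ f' ≠ a := by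
  obtain ⟨e, e', hE⟩ := exists_linePair hdes hss h.ca.2.swap_first.swap_mid
  obtain ⟨f, f', hF⟩ := exists_linePair hdes hss h.xb.2.swap_mid
  refine ⟨e, e', f, f', hE, hF, ?_, ?_, ?_, ?_⟩ <;> rintro rfl
  · exact h.not_quadLine hdes hss _ hE.2.swap_mid.swap_first
  · exact h.not_quadLine hdes hss _ hE.2.swap_last.swap_mid.swap_first
  · exact h.not_quadLine hdes hss _ hF.2.swap_mid
  · exact h.not_quadLine hdes hss _ hF.2.swap_last.swap_mid

lemma col_ne (hdes : IsTwoDesign B 2) (hss : HGSupersimple B) (hc : HoleColoring B x 3 col)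
    (h : HexLine B x col a b c a₁ a₂ b₁ b₂ c₁ c₂) : col a ≠ col b := by
  intro hab
  obtain ⟨e, e', f, f', hE, hF, hex, hex', -, -⟩ := h.exists_linePairs hdes hss
  have hxa := hdes.quadLine_ne h.xa.1
  have hxb := hdes.quadLine_ne h.xb.2
  have hD' := h.xa.pairMove_apply hdes
  have hE' := hE.pairMove_apply hdes
  have hF' := hF.pairMove_apply hdes
  have hm := (hc.move h.xa hE hF a b).1 hab
  rw [hD'.2.1, pairMove_apply_of_ne hxa.1 hxb.2.1 hxa.2.2.1 hxb.2.2.1 hex.symm hex'.symm, hF'.1,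
    hD'.2.2.1, hE'.2.2.1, hF'.2.2.2.1, (h.fst b₁).2 (by simp), eq_comm, h.fst] at hm
  rcases hm with hm | hm | hm
  · exact h.xa.3 hm
  · exact hxb.2.2.2.1 hm
  · exact h.xc.5 hm

lemma col_ne_pair (hdes : IsTwoDesign B 2) (h : HexLine B x col a b c a₁ a₂ b₁ b₂ c₁ c₂) :
    col a ≠ col a₁ ∧ col a ≠ col a₂ := by
  have hxa := hdes.quadLine_ne h.xa.2
  have hca := hdes.quadLine_ne h.ca.2
  have h₁ := h.xc.3
  have h₂ := h.xc.4
  rw [Ne, Ne, h.fst, h.snd]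
  tauto

lemma not_quadLine_fst (hdes : IsTwoDesign B 2) (hss : HGSupersimple B)
    (hc : HoleColoring B x 3 col) (h : HexLine B x col a b c a₁ a₂ b₁ b₂ c₁ c₂) {z : Ω} :
    ¬ QuadLine B x b₁ c₁ z := by
  intro hz
  obtain ⟨f, f', hF⟩ := exists_linePair hdes hss h.xb.2.swap_mid
  have hb₂ : col b₂ = col a₂ := (h.snd b₂).2 (by simp)
  have hbb₂ : col b ≠ col b₂ := (h.rotate.col_ne_pair hdes).2
  have hbc : col b ≠ col c := h.rotate.col_ne hdes hss hc
  have hca₂ : col c ≠ col a₂ := by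
    rw [← (h.snd c₂).2 (by simp)]
    exact (h.rotate.rotate.col_ne_pair hdes).2
  obtain ⟨f, hf⟩ : ∃ f, LinePair B x b₁ c₁ f b b₂ := by
    have hne : c₁ ≠ b ∧ c₁ ≠ b₂ := by
      have hn := h.nodup
      simp only [List.nodup_cons, List.mem_cons, List.not_mem_nil, not_or] at hn
      exact ⟨h.xc.5.symm, by tauto⟩
    rcases hF.line_cases hdes hss hz with hh | hh | ⟨rfl, -⟩ | ⟨rfl, -⟩
    · exact absurd hh.1 hne.1
    · exact absurd hh.1 hne.2
    · exact ⟨_, hF.swap_lines⟩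
    · exact ⟨_, hF.swap_lines.swap_fst⟩
  obtain ⟨p₁, p₂, q₁, q₂, H⟩ := hc.exists_hexLine hdes hss hf hbb₂
  have hp₁ : col p₁ = col b := (H.fst p₁).2 (by simp)
  have hp₂ : col p₂ = col b₂ := (H.snd p₂).2 (by simp)
  rcases H.xb.line_cases hdes hss h.xc.2.swap_mid with hh | hh | hh | hh
  · have hn := h.nodup
    simp only [List.nodup_cons, List.mem_cons, List.not_mem_nil, not_or] at hn
    exact hn.2.2.1.2.2.1 hh.2.symm
  · exact h.xb.3 hh.1
  · exact hbc (by rw [hh.1, hp₁])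
  · exact hca₂ (by rw [hh.1, hp₂, hb₂])

lemma not_quadLine_snd (hdes : IsTwoDesign B 2) (hss : HGSupersimple B)
    (hc : HoleColoring B x 3 col) (h : HexLine B x col a b c a₁ a₂ b₁ b₂ c₁ c₂) {e e' f : Ω}
    (hE : LinePair B a b₁ c b₂ e e') (hc₁ : c₁ = e ∨ c₁ = e') (hf : col f = col a) :
    ¬ QuadLine B x b₁ a₂ f := by
  intro hz
  have hca := hdes.quadLine_ne h.ca.2
  obtain ⟨haa₁, haa₂⟩ := h.col_ne_pair hdes
  have hb₂ : col b₂ = col a₂ := (h.snd b₂).2 (by simp)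
  have hcc₁ : col c₁ = col a₁ := (h.fst c₁).2 (by simp)
  have hn := h.nodup
  simp only [List.nodup_cons, List.mem_cons, List.not_mem_nil, not_or] at hn
  have hfa : f ≠ a := by
    rintro rfl
    exact h.not_quadLine hdes hss a₂ hz.swap_last.swap_mid
  have hfa₁ : f ≠ a₁ := by
    rintro rfl
    exact haa₁ hf.symm
  have hL : LinePair B x a₂ b₁ f a a₁ := ⟨hz.swap_mid, h.xa.2.swap_last.swap_mid,
    hca.2.2.2.1.symm, by tauto, hfa, hfa₁⟩
  obtain ⟨p₁, p₂, q₁, q₂, H⟩ := hc.exists_hexLine hdes hss hL haa₁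
  rcases hE.line_cases hdes hss H.bc.2.swap_mid.swap_first with hh | hh | hh | hh
  · exact hn.1.2.2.1 hh.2
  · exact haa₂ (by rw [← hf, hh.1, hb₂])
  · rcases hc₁ with hc₁ | hc₁
    · exact haa₁ (by rw [← hf, hh.1, ← hc₁, hcc₁])
    · exact hn.1.2.2.2.1 (hh.2.trans hc₁.symm)
  · rcases hc₁ with hc₁ | hc₁
    · exact hn.1.2.2.2.1 (hh.2.trans hc₁.symm)
    · exact haa₁ (by rw [← hf, hh.1, ← hc₁, hcc₁])

/-- A block system with blocks of size three has no hexad line. -/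
lemma false_of_holeColoring (hdes : IsTwoDesign B 2) (hss : HGSupersimple B)
    (hc : HoleColoring B x 3 col) (h : HexLine B x col a b c a₁ a₂ b₁ b₂ c₁ c₂) : False := by
  obtain ⟨e, e', f, f', hE, hF, hex, hex', hfa, hfa'⟩ := h.exists_linePairs hdes hss
  have hxa := hdes.quadLine_ne h.xa.1
  have hxa' := hdes.quadLine_ne h.xa.2
  have hxb := hdes.quadLine_ne h.xb.2
  have hxc := hdes.quadLine_ne h.xc.2
  have hca := hdes.quadLine_ne h.ca.2
  have hn := h.nodup
  simp only [List.nodup_cons, List.mem_cons, List.not_mem_nil, not_or] at hn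
  have hD' := h.xa.pairMove_apply hdes
  have hE' := hE.pairMove_apply hdes
  have hF' := hF.pairMove_apply hdes
  have hb₁ : col b₁ = col a₁ := (h.fst b₁).2 (by simp)
  have hc₁ : col c₁ = col a₁ := (h.fst c₁).2 (by simp)
  obtain ⟨haa₁, haa₂⟩ := h.col_ne_pair hdes
  have hm := fun z => hc.move h.xa hE hF b₁ z
  have hDb₁ : pairMove x a b c a₁ a₂ b₁ = b₁ :=
    pairMove_apply_of_ne hxb.2.1.symm hca.2.2.2.1.symm hxb.2.2.2.1.symm hca.2.1.symm
      (Ne.symm hn.1.2.1) (Ne.symm hn.2.1.1)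
  have hDc₁ : pairMove x a b c a₁ a₂ c₁ = c₁ :=
    pairMove_apply_of_ne hxc.2.1.symm h.xc.3.symm h.xc.5.symm hxc.2.2.2.1.symm
      (Ne.symm hn.1.2.2.2.1) (Ne.symm hn.2.1.2.2.1)
  have hFa : pairMove x b₁ b b₂ f f' a = a :=
    pairMove_apply_of_ne hxa.1.symm hca.2.2.2.1 hxa.2.2.2.1 hca.2.2.2.2.1 hfa.symm hfa'.symm
  have hm₁ := (hm c₁).1 (hb₁.trans hc₁.symm)
  have hm₂ := (hm a₁).1 hb₁
  rw [hDb₁, hE'.2.1, hFa, hDc₁] at hm₁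
  rw [hDb₁, hE'.2.1, hFa, hD'.2.2.2.2.1] at hm₂
  have hEc₁ := pairMove_apply_eq_or (e := e) (f := e') h.xc.3.symm (Ne.symm hn.2.2.1.2.1)
    hxc.2.2.2.1.symm (Ne.symm hn.2.2.2.1.1)
  have hEa₂ := pairMove_apply_eq_or (e := e) (f := e') hxa'.2.2.2.2.1.symm hn.2.1.1 h.xa.6.symm
    hn.2.1.2.1
  have hFc₁ := pairMove_apply_eq_or (e := f) (f := f') hxc.2.1.symm (Ne.symm hn.2.2.1.2.1)
    h.xc.5.symm (Ne.symm hn.2.2.2.1.1)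
  have hFa₂ := pairMove_apply_eq_or (e := f) (f := f') hxa'.2.2.1.symm hn.2.1.1 h.xa.4.symm
    hn.2.1.2.1
  replace hFc₁ : pairMove x b₁ b b₂ f f' c₁ = c₁ := by
    rcases hFc₁ with rfl | rfl | hFc₁
    · exact absurd hF.2 (h.not_quadLine_fst hdes hss hc)
    · exact absurd hF.2.swap_last (h.not_quadLine_fst hdes hss hc)
    · exact hFc₁
  replace hEc₁ : c₁ = e ∧ pairMove a b₁ c b₂ e e' e' = c₁ ∨
      c₁ = e' ∧ pairMove a b₁ c b₂ e e' e = c₁ := by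
    rcases hEc₁ with rfl | rfl | hEc₁
    · exact Or.inl ⟨rfl, hE'.2.2.2.2.2⟩
    · exact Or.inr ⟨rfl, hE'.2.2.2.2.1⟩
    · rw [hEc₁, hFc₁] at hm₁
      exact absurd (hm₁.trans hc₁) haa₁
  have hac : a₂ ≠ c₁ := hn.2.1.2.2.1
  replace hEa₂ : pairMove a b₁ c b₂ e e' a₂ = a₂ := by
    have hne : pairMove a b₁ c b₂ e e' a₂ ≠ c₁ := fun hh => by
      rw [hh, hFc₁] at hm₂
      exact haa₁ (hm₂.trans hc₁)
    rcases hEa₂ with hh | hh | hh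
    · rcases hEc₁ with hcc | hcc
      · exact absurd (hh.trans hcc.1.symm) hac
      · exact absurd (hh ▸ hcc.2) hne
    · rcases hEc₁ with hcc | hcc
      · exact absurd (hh ▸ hcc.2) hne
      · exact absurd (hh.trans hcc.1.symm) hac
    · exact hh
  have hsnd := fun z => h.not_quadLine_snd hdes hss hc (f := z) hE (hEc₁.imp And.left And.left)
  rw [hEa₂] at hm₂
  rcases hFa₂ with rfl | rfl | hFa₂
  · rw [hF'.2.2.2.2.1] at hm₂
    exact hsnd _ hm₂.symm hF.2
  · rw [hF'.2.2.2.2.2] at hm₂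
    exact hsnd _ hm₂.symm hF.2.swap_last
  · exact haa₂ (by rw [hm₂, hFa₂])

end HexLine

/-- (Lemma 6.8) If `n ≥ 10` and the hole stabilizer of a supersimple
2-(n,4,2) design is transitive on `Ω \ {∞}` and preserves a system of imprimitivity with
`ℓ` blocks of size `k`, then `k = 2` or `k = 4`. -/
theorem stmt18 (B : Finset (Finset Ω)) (n : ℕ) (hn : Fintype.card Ω = n) (hn10 : 10 ≤ n)
    (hdes : IsTwoDesign B 2) (hss : HGSupersimple B) (x : Ω)
    (htrans : ∀ a b : Ω, a ≠ x → b ≠ x → ∃ g ∈ holeStab B x, g a = b)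
    (P : Finset (Finset Ω)) (k ℓ : ℕ) (hP : IsHoleBlockSystem B x P k ℓ) :
    k = 2 ∨ k = 4 := by
  have hc := hP.holeColoring hdes hss
  obtain ⟨hℓ, hk, hℓ1, hcard, -, hx, -⟩ := hP
  obtain ⟨Δ, hΔ, Δ', hΔ', hne⟩ := Finset.one_lt_card.1 (hℓ ▸ hℓ1 : 1 < P.card)
  obtain ⟨a, haΔ⟩ := Finset.card_pos.1 (by rw [hcard Δ hΔ]; omega : 0 < Δ.card)
  have hax : a ≠ x := fun h => hx Δ hΔ (h ▸ haΔ)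
  obtain hk' | hk' | hk' : k = 2 ∨ k = 3 ∨ 4 ≤ k := by omega
  · exact Or.inl hk'
  · subst hk'
    obtain ⟨a, b, c, d₁, d₂, h, hd⟩ := hc.exists_corner_ne hdes hss hax
    obtain ⟨_, _, _, _, H⟩ := hc.exists_hexLine hdes hss h hd
    exact (H.false_of_holeColoring hdes hss hc).elim
  · exfalso
    have hsub : Δ' ⊆ Δ := fun b hb => by
      have hab := hc.col_eq_of_four_le hdes hss hk' hax fun h => hx Δ' hΔ' (h ▸ hb)
      have hmem : Δ ∈ P.filter (b ∈ ·) := hab ▸ Finset.mem_filter.2 ⟨hΔ, haΔ⟩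
      exact (Finset.mem_filter.1 hmem).2
    refine hne (Finset.eq_of_subset_of_card_le hsub ?_).symm
    rw [hcard Δ hΔ, hcard Δ' hΔ']
end

section
/- Let 𝓓 = (Ω, 𝓑) be a supersimple 2-(n,4,2) design, let ∞ ∈ Ω, and suppose G = π_∞(𝓓) is transitive on Ω \ {∞} and preserves a system of imprimitivity with ℓ blocks each of size k. Then n ≤ 13. -/
open Equiv

variable {Ω : Type*} [DecidableEq Ω] [Fintype Ω]

/-- The points forming, together with `a` and `b`, three distinct points of a line. -/
def collinearThird (B : Finset (Finset Ω)) (a b : Ω) : Finset Ω :=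
  Finset.univ.filter fun z => a ≠ b ∧ z ≠ a ∧ z ≠ b ∧ ∃ l ∈ B, a ∈ l ∧ b ∈ l ∧ z ∈ l

set_option linter.unusedSectionVars false

section Design

variable {B : Finset (Finset Ω)}

theorem mem_collinearThird {a b z : Ω} :
    z ∈ collinearThird B a b ↔
      a ≠ b ∧ z ≠ a ∧ z ≠ b ∧ ∃ l ∈ B, a ∈ l ∧ b ∈ l ∧ z ∈ l := by
  simp [collinearThird]

theorem collinearThird_comm (a b : Ω) : collinearThird B a b = collinearThird B b a := by
  ext z
  simp only [mem_collinearThird]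
  grind

theorem mem_collinearThird_swap {a b z : Ω} :
    z ∈ collinearThird B a b ↔ b ∈ collinearThird B a z := by
  simp only [mem_collinearThird]
  grind

theorem IsTwoDesign.distinct {lam : ℕ} (h : IsTwoDesign B lam) {a b c d : Ω}
    (hl : ({a, b, c, d} : Finset Ω) ∈ B) :
    a ≠ b ∧ a ≠ c ∧ a ≠ d ∧ b ≠ c ∧ b ≠ d ∧ c ≠ d := by
  have h4 := h.1 _ hl
  have h3 : ∀ u v w : Ω, ({u, v, w} : Finset Ω).card ≤ 3 := fun u v w => Finset.card_le_three
  refine ⟨?_, ?_, ?_, ?_, ?_, ?_⟩ <;> rintro rfl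
  · have := h3 a c d; simp at h4; omega
  · have := h3 a b d
    rw [show ({a, b, a, d} : Finset Ω) = {a, b, d} by grind] at h4; omega
  · have := h3 a b c
    rw [show ({a, b, c, a} : Finset Ω) = {a, b, c} by grind] at h4; omega
  · have := h3 a b d; simp at h4; omega
  · have := h3 a b c
    rw [show ({a, b, c, b} : Finset Ω) = {a, b, c} by grind] at h4; omega
  · have := h3 a b c; simp at h4; omega

/-- Two distinct lines of a supersimple hypergraph do not share three points. -/
theorem HGSupersimple.line_unique (h : HGSupersimple B) {l m : Finset Ω} (hl : l ∈ B) (hm : m ∈ B)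
    {p q r : Ω} (hpq : p ≠ q) (hpr : p ≠ r) (hqr : q ≠ r)
    (hpl : p ∈ l) (hql : q ∈ l) (hrl : r ∈ l) (hpm : p ∈ m) (hqm : q ∈ m) (hrm : r ∈ m) :
    l = m := by
  by_contra hne
  have h2 := h l hl m hm hne
  have h3 : ({p, q, r} : Finset Ω) ⊆ l ∩ m := by
    intro z hz
    simp only [Finset.mem_insert, Finset.mem_singleton] at hz
    rcases hz with rfl | rfl | rfl <;> simp [*]
  have := Finset.card_le_card h3
  rw [Finset.card_eq_three.2 ⟨p, q, r, hpq, hpr, hqr, rfl⟩] at this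
  omega

theorem fourth_unique {lam : ℕ} (h : IsTwoDesign B lam) (hs : HGSupersimple B) {a b c d d' : Ω}
    (hl : ({a, b, c, d} : Finset Ω) ∈ B) (hm : ({a, b, c, d'} : Finset Ω) ∈ B) : d = d' := by
  have h1 := h.distinct hl
  have h2 := h.distinct hm
  have : ({a, b, c, d} : Finset Ω) = {a, b, c, d'} :=
    hs.line_unique hl hm (p := a) (q := b) (r := c) (by tauto) (by tauto) (by tauto)
      (by simp) (by simp) (by simp) (by simp) (by simp) (by simp)
  have hd : d ∈ ({a, b, c, d'} : Finset Ω) := this ▸ by simp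
  grind

theorem mem_collinearThird_of_line {lam : ℕ} (h : IsTwoDesign B lam) {a b c d : Ω}
    (hl : ({a, b, c, d} : Finset Ω) ∈ B) : c ∈ collinearThird B a b := by
  have h1 := h.distinct hl
  exact mem_collinearThird.2 ⟨by tauto, by tauto, by tauto, _, hl, by simp, by simp, by simp⟩

theorem exists_fourth {lam : ℕ} (h : IsTwoDesign B lam) {a b c : Ω}
    (hc : c ∈ collinearThird B a b) : ∃ d, ({a, b, c, d} : Finset Ω) ∈ B := by
  obtain ⟨hab, hca, hcb, l, hl, ha, hb, hcl⟩ := mem_collinearThird.1 hc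
  have h4 := h.1 l hl
  have hsub : ({a, b, c} : Finset Ω) ⊆ l := by
    intro z hz
    simp only [Finset.mem_insert, Finset.mem_singleton] at hz
    rcases hz with rfl | rfl | rfl <;> assumption
  have h3 : ({a, b, c} : Finset Ω).card = 3 :=
    Finset.card_eq_three.2 ⟨a, b, c, hab, hca.symm, hcb.symm, rfl⟩
  have h1 := Finset.card_sdiff_of_subset hsub
  rw [h4, h3] at h1
  obtain ⟨d, hd⟩ := Finset.card_eq_one.1 h1
  refine ⟨d, ?_⟩
  have : ({a, b, c, d} : Finset Ω) = l := by
    have hu := Finset.sdiff_union_of_subset hsub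
    rw [hd] at hu
    rw [← hu]
    ext z
    simp only [Finset.mem_insert, Finset.mem_singleton, Finset.mem_union]
    tauto
  rwa [this]

theorem exists_eq_of_mem_line {lam : ℕ} (h : IsTwoDesign B lam) {a b : Ω} (hab : a ≠ b)
    {l : Finset Ω} (hl : l ∈ B) (ha : a ∈ l) (hb : b ∈ l) :
    ∃ p q, p ≠ q ∧ l = {a, b, p, q} := by
  have hsub : ({a, b} : Finset Ω) ⊆ l := by
    simp [Finset.insert_subset_iff, ha, hb]
  have h1 := Finset.card_sdiff_of_subset hsub
  rw [h.1 l hl, Finset.card_pair hab] at h1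
  obtain ⟨p, q, hpq, hd⟩ := Finset.card_eq_two.1 h1
  refine ⟨p, q, hpq, ?_⟩
  rw [← Finset.sdiff_union_of_subset hsub, hd, Finset.union_comm, Finset.insert_union,
    Finset.singleton_union]

/-- The two lines through a pair of points. -/
theorem exists_two_lines (h : IsTwoDesign B 2) (hs : HGSupersimple B) {a b : Ω} (hab : a ≠ b) :
    ∃ p q r s : Ω, [p, q, r, s].Nodup ∧
      ({a, b, p, q} : Finset Ω) ∈ B ∧ ({a, b, r, s} : Finset Ω) ∈ B ∧
      ∀ l ∈ B, a ∈ l → b ∈ l → l = {a, b, p, q} ∨ l = {a, b, r, s} := by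
  obtain ⟨l, m, hlm, hf⟩ := Finset.card_eq_two.1 (h.2 a b hab)
  have hl : l ∈ B ∧ a ∈ l ∧ b ∈ l := by
    have : l ∈ B.filter fun l => a ∈ l ∧ b ∈ l := hf ▸ by simp
    simpa using this
  have hm : m ∈ B ∧ a ∈ m ∧ b ∈ m := by
    have : m ∈ B.filter fun l => a ∈ l ∧ b ∈ l := hf ▸ by simp
    simpa using this
  obtain ⟨p, q, hpq, rfl⟩ := exists_eq_of_mem_line h hab hl.1 hl.2.1 hl.2.2
  obtain ⟨r, s, hrs, rfl⟩ := exists_eq_of_mem_line h hab hm.1 hm.2.1 hm.2.2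
  have d1 := h.distinct hl.1
  have hne : ∀ z, z ≠ a → z ≠ b → z ∈ ({a, b, p, q} : Finset Ω) →
      z ∉ ({a, b, r, s} : Finset Ω) := fun z ha hb hz hz' =>
    hlm (hs.line_unique hl.1 hm.1 (p := a) (q := b) (r := z) hab ha.symm hb.symm
      (by simp) (by simp) hz (by simp) (by simp) hz')
  have hp := hne p d1.2.1.symm d1.2.2.2.1.symm (by simp)
  have hq := hne q d1.2.2.1.symm d1.2.2.2.2.1.symm (by simp)
  refine ⟨p, q, r, s, ?_, hl.1, hm.1, ?_⟩
  · simp only [Finset.mem_insert, Finset.mem_singleton] at hp hq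
    simp only [not_or] at hp hq
    simp [hp, hq, hpq, hrs]
  · intro l' hl' ha hb
    have : l' ∈ B.filter fun l => a ∈ l ∧ b ∈ l := Finset.mem_filter.2 ⟨hl', ha, hb⟩
    rw [hf] at this
    simpa using this

theorem card_collinearThird (h : IsTwoDesign B 2) (hs : HGSupersimple B) {a b : Ω}
    (hab : a ≠ b) : (collinearThird B a b).card = 4 := by
  obtain ⟨p, q, r, s, hnd, hl, hm, hall⟩ := exists_two_lines h hs hab
  have d1 := h.distinct hl
  have d2 := h.distinct hm
  have : collinearThird B a b = [p, q, r, s].toFinset := by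
    ext z
    simp only [mem_collinearThird, List.mem_toFinset]
    constructor
    · rintro ⟨-, hza, hzb, l, hlB, ha, hb, hz⟩
      rcases hall l hlB ha hb with rfl | rfl <;>
      · simp only [Finset.mem_insert, Finset.mem_singleton] at hz
        simp only [List.mem_cons]
        tauto
    · intro hz
      simp only [List.mem_cons, List.not_mem_nil, or_false] at hz
      rcases hz with rfl | rfl | rfl | rfl
      · exact ⟨hab, by tauto, by tauto, _, hl, by simp, by simp, by simp⟩
      · exact ⟨hab, by tauto, by tauto, _, hl, by simp, by simp, by simp⟩
      · exact ⟨hab, by tauto, by tauto, _, hm, by simp, by simp, by simp⟩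
      · exact ⟨hab, by tauto, by tauto, _, hm, by simp, by simp, by simp⟩
  rw [this, List.toFinset_card_of_nodup hnd]
  rfl

theorem exists_isElemMove (h : IsTwoDesign B 2) (hs : HGSupersimple B) {a b : Ω} (hab : a ≠ b) :
    ∃ e : Equiv.Perm Ω, IsElemMove B a b e := by
  obtain ⟨p, q, r, s, hnd, hl, hm, hall⟩ := exists_two_lines h hs hab
  have d1 := h.distinct hl
  have d2 := h.distinct hm
  simp only [List.nodup_cons, List.mem_cons, List.not_mem_nil, or_false, List.nodup_nil] at hnd
  refine ⟨swap a b * swap p q * swap r s, Or.inr ⟨hab, ⟨_, hl, by simp, by simp⟩, ?_, ?_, ?_⟩⟩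
  · simp only [Perm.mul_apply, swap_apply_def]; grind
  · simp only [Perm.mul_apply, swap_apply_def]; grind
  · intro z hza hzb
    refine ⟨fun hz => ?_, fun l hlB ha hb hz w hw hwa hwb hwz => ?_⟩
    · have h1 := hz _ hl
      have h2 := hz _ hm
      simp only [Finset.mem_insert, Finset.mem_singleton] at h1 h2
      simp only [Perm.mul_apply, swap_apply_def]
      grind
    · rcases hall l hlB ha hb with rfl | rfl <;>
      · simp only [Finset.mem_insert, Finset.mem_singleton] at hz hw
        simp only [Perm.mul_apply, swap_apply_def]
        grind

theorem IsElemMove.apply_left {a b : Ω} {e : Equiv.Perm Ω} (he : IsElemMove B a b e) :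
    e a = b := by
  rcases he with ⟨rfl, rfl⟩ | he
  · rfl
  · exact he.2.2.1

theorem IsElemMove.apply_right {a b : Ω} {e : Equiv.Perm Ω} (he : IsElemMove B a b e) :
    e b = a := by
  rcases he with ⟨rfl, rfl⟩ | he
  · rfl
  · exact he.2.2.2.1

theorem IsElemMove.apply_of_notMem {a b z : Ω} {e : Equiv.Perm Ω} (he : IsElemMove B a b e)
    (hza : z ≠ a) (hzb : z ≠ b) (hz : z ∉ collinearThird B a b) : e z = z := by
  rcases he with ⟨rfl, rfl⟩ | he
  · rfl
  · refine (he.2.2.2.2 z hza hzb).1 fun l hl hlz => hz ?_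
    exact mem_collinearThird.2 ⟨he.1, hza, hzb, l, hl, hlz⟩

theorem IsElemMove.apply_of_line {lam : ℕ} (h : IsTwoDesign B lam) {a b z w : Ω}
    {e : Equiv.Perm Ω} (he : IsElemMove B a b e) (hl : ({a, b, z, w} : Finset Ω) ∈ B) :
    e z = w := by
  have d := h.distinct hl
  rcases he with ⟨rfl, rfl⟩ | he
  · tauto
  · exact (he.2.2.2.2 z (by tauto) (by tauto)).2 _ hl (by simp) (by simp) (by simp) w (by simp)
      (by tauto) (by tauto) (by tauto)

/-- The triangle `[o, a, b, o]` for non-collinear `o, a, b`, and its action on some points. -/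
theorem exists_triangle (h : IsTwoDesign B 2) (hs : HGSupersimple B) {o a b : Ω} (hao : a ≠ o)
    (hbo : b ≠ o) (hab : a ≠ b) (hb : b ∉ collinearThird B o a) :
    ∃ g ∈ holeStab B o, g a = b ∧ g b = a ∧
      (∀ z, z ≠ o → z ≠ a → z ≠ b → z ∉ collinearThird B o a → z ∉ collinearThird B a b →
        z ∉ collinearThird B b o → g z = z) ∧
      (∀ z y, z ≠ a → z ∉ collinearThird B o a → z ∉ collinearThird B a b →
        ({b, o, z, y} : Finset Ω) ∈ B → g z = y) ∧
      (∀ d e, ({o, a, d, e} : Finset Ω) ∈ B → e ∉ collinearThird B a b →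
        e ∉ collinearThird B b o → g d = e) := by
  obtain ⟨e₁, h₁⟩ := exists_isElemMove h hs hao.symm
  obtain ⟨e₂, h₂⟩ := exists_isElemMove h hs hab
  obtain ⟨e₃, h₃⟩ := exists_isElemMove h hs hbo
  have ho : o ∉ collinearThird B a b := by
    simp only [mem_collinearThird] at hb ⊢; grind
  have ha : a ∉ collinearThird B b o := by
    simp only [mem_collinearThird] at hb ⊢; grind
  refine ⟨1 * e₃ * e₂ * e₁, ⟨[o, a, b, o], rfl, rfl, e₁, _, h₁, ⟨e₂, _, h₂, ⟨e₃, _, h₃, rfl, rfl⟩,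
    rfl⟩, rfl⟩, ?_, ?_, ?_, ?_, ?_⟩
  · rw [Perm.mul_apply, Perm.mul_apply, one_mul, h₁.apply_right,
      h₂.apply_of_notMem hao.symm hbo.symm ho, h₃.apply_right]
  · rw [Perm.mul_apply, Perm.mul_apply, one_mul, h₁.apply_of_notMem hbo hab.symm hb,
      h₂.apply_right, h₃.apply_of_notMem hab hao ha]
  · intro z zo za zb z1 z2 z3
    rw [Perm.mul_apply, Perm.mul_apply, one_mul, h₁.apply_of_notMem zo za z1,
      h₂.apply_of_notMem za zb z2, h₃.apply_of_notMem zb zo z3]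
  · intro z y za z1 z2 hl
    have d := h.distinct hl
    rw [Perm.mul_apply, Perm.mul_apply, one_mul, h₁.apply_of_notMem (by tauto) za z1,
      h₂.apply_of_notMem za (by tauto) z2, h₃.apply_of_line h hl]
  · intro d e hl he2 he3
    have dd := h.distinct hl
    have heb : e ≠ b := by
      rintro rfl
      apply hb
      exact mem_collinearThird.2 ⟨hao.symm, hbo, hab.symm, _, hl, by simp, by simp, by simp⟩
    rw [Perm.mul_apply, Perm.mul_apply, one_mul, h₁.apply_of_line h hl,
      h₂.apply_of_notMem (by tauto) heb he2, h₃.apply_of_notMem heb (by tauto) he3]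

/-- The replication number condition for a 2-(n,4,2) design. -/
theorem IsTwoDesign.three_dvd (h : IsTwoDesign B 2) (o : Ω) :
    3 ∣ 2 * (Fintype.card Ω - 1) := by
  have := Finset.sum_card_bipartiteAbove_eq_sum_card_bipartiteBelow (fun (z : Ω) l => z ∈ l)
    (s := Finset.univ.erase o) (t := B.filter (o ∈ ·))
  have h2 : ∀ z ∈ Finset.univ.erase o,
      (Finset.bipartiteAbove (fun (z : Ω) l => z ∈ l) (B.filter (o ∈ ·)) z).card = 2 := by
    intro z hz
    rw [← h.2 o z (Finset.ne_of_mem_erase hz).symm, Finset.bipartiteAbove, Finset.filter_filter]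
  have h3 : ∀ l ∈ B.filter (o ∈ ·),
      (Finset.bipartiteBelow (fun (z : Ω) l => z ∈ l) (Finset.univ.erase o) l).card = 3 := by
    intro l hl
    rw [Finset.mem_filter] at hl
    have : Finset.bipartiteBelow (fun (z : Ω) l => z ∈ l) (Finset.univ.erase o) l = l.erase o := by
      ext z; simp [Finset.mem_bipartiteBelow]
    rw [this, Finset.card_erase_of_mem hl.2, h.1 l hl.1]
  rw [Finset.sum_const_nat h2, Finset.sum_const_nat h3,
    Finset.card_erase_of_mem (Finset.mem_univ o), Finset.card_univ] at this
  omega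

end Design

section Blocks

variable {B : Finset (Finset Ω)} {o : Ω} {P : Finset (Finset Ω)} {k ℓ : ℕ}

theorem IsHoleBlockSystem.card_eq (hP : IsHoleBlockSystem B o P k ℓ) :
    Fintype.card Ω - 1 = ℓ * k := by
  obtain ⟨hℓ, -, -, hk, hex, ho, -⟩ := hP
  have h1 : Finset.univ.erase o = P.biUnion id := by
    ext z
    simp only [Finset.mem_erase, Finset.mem_univ, and_true, Finset.mem_biUnion, id]
    constructor
    · intro hz
      obtain ⟨Δ, hΔ, -⟩ := hex z hz
      exact ⟨Δ, hΔ⟩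
    · rintro ⟨Δ, hΔ, hz⟩ rfl
      exact ho Δ hΔ hz
  rw [← Finset.card_univ, ← Finset.card_erase_of_mem (Finset.mem_univ o), h1,
    Finset.card_biUnion, ← hℓ]
  · exact Finset.sum_const_nat hk
  · intro Δ hΔ Δ' hΔ' hne
    rw [Function.onFun, Finset.disjoint_left]
    intro z hz hz'
    exact hne ((hex z fun h => ho Δ hΔ (h ▸ hz)).unique ⟨hΔ, hz⟩ ⟨hΔ', hz'⟩)

/-- `β` assigns to every point other than `o` the block containing it. -/
structure IsBlockMap (B : Finset (Finset Ω)) (o : Ω) (k : ℕ) (β : Ω → Finset Ω) : Prop where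
  card_eq : ∀ a, a ≠ o → (β a).card = k
  notMem : ∀ a, a ≠ o → o ∉ β a
  mem_self : ∀ a, a ≠ o → a ∈ β a
  eq_of_mem : ∀ a b, a ≠ o → b ∈ β a → β b = β a
  mem_of_mem : ∀ g ∈ holeStab B o, ∀ a z, a ≠ o → g a ≠ o → z ∈ β a → g z ∈ β (g a)

theorem IsHoleBlockSystem.exists_isBlockMap (hP : IsHoleBlockSystem B o P k ℓ) :
    ∃ β, IsBlockMap B o k β := by
  obtain ⟨-, -, -, hk, hex, ho, hg⟩ := hP
  choose! β hβ hu using hex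
  simp only [and_imp] at hu
  refine ⟨β, fun a ha => hk _ (hβ a ha).1, fun a ha => ho _ (hβ a ha).1, fun a ha => (hβ a ha).2,
    fun a b ha hb => ?_, fun g hgs a z ha hga hz => ?_⟩
  · refine (hu b (fun h => ho _ (hβ a ha).1 (h ▸ hb)) _ (hβ a ha).1 hb).symm
  · rw [← hu (g a) hga _ (hg g hgs _ (hβ a ha).1) (Finset.mem_image_of_mem _ (hβ a ha).2)]
    exact Finset.mem_image_of_mem _ hz

namespace IsBlockMap

variable {β : Ω → Finset Ω}

theorem ne_of_mem (hβ : IsBlockMap B o k β) {a z : Ω} (ha : a ≠ o) (hz : z ∈ β a) : z ≠ o :=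
  fun h => hβ.notMem a ha (h ▸ hz)

theorem mem_symm (hβ : IsBlockMap B o k β) {a z : Ω} (ha : a ≠ o) (hz : z ∈ β a) : a ∈ β z := by
  rw [hβ.eq_of_mem a z ha hz]
  exact hβ.mem_self a ha

theorem notMem_of_mem (hβ : IsBlockMap B o k β) {a b z : Ω} (ha : a ≠ o) (hb : b ≠ o)
    (hba : b ∉ β a) (hz : z ∈ β a) : z ∉ β b := fun hz' =>
  hba (by rw [← hβ.eq_of_mem a z ha hz, hβ.eq_of_mem b z hb hz']; exact hβ.mem_self b hb)

section Triangle

variable {a b : Ω}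

theorem subset_of_notMem (hβ : IsBlockMap B o k β) (h : IsTwoDesign B 2) (hs : HGSupersimple B)
    (ha : a ≠ o) (hb : b ≠ o) (hba : b ∉ β a) (hc : b ∉ collinearThird B o a) :
    β a ∪ β b ⊆ {a, b} ∪ (collinearThird B o a ∪ (collinearThird B a b ∪
      collinearThird B b o)) := by
  have hab : a ≠ b := fun h => hba (h ▸ hβ.mem_self a ha)
  obtain ⟨g, hg, hga, hgb, hfix, -, -⟩ := exists_triangle h hs ha hb hab hc
  intro z hz
  by_contra hcon
  simp only [Finset.mem_union, Finset.mem_insert, Finset.mem_singleton, not_or] at hcon hz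
  have hzo : z ≠ o := hz.elim (hβ.ne_of_mem ha) (hβ.ne_of_mem hb)
  have hgz := hfix z hzo hcon.1.1 hcon.1.2 hcon.2.1 hcon.2.2.1 hcon.2.2.2
  rcases hz with hz | hz
  · have := hβ.mem_of_mem g hg a z ha (hga ▸ hb) hz
    rw [hgz, hga] at this
    exact hβ.notMem_of_mem ha hb hba hz this
  · have := hβ.mem_of_mem g hg b z hb (hgb ▸ ha) hz
    rw [hgz, hgb] at this
    exact hβ.notMem_of_mem ha hb hba this hz

theorem exists_line_of_notMem (hβ : IsBlockMap B o k β) (h : IsTwoDesign B 2)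
    (hs : HGSupersimple B) (ha : a ≠ o) (hb : b ≠ o) (hba : b ∉ β a)
    (hc : b ∉ collinearThird B o a) {z : Ω} (hz : z ∈ β a) (hza : z ≠ a)
    (hzc : z ∉ collinearThird B o a) :
    z ∈ collinearThird B a b ∨ ∃ y ∈ β b, ({b, o, z, y} : Finset Ω) ∈ B := by
  have hab : a ≠ b := fun h => hba (h ▸ hβ.mem_self a ha)
  obtain ⟨g, hg, hga, hgb, -, hmv, -⟩ := exists_triangle h hs ha hb hab hc
  by_cases hz2 : z ∈ collinearThird B a b
  · exact Or.inl hz2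
  have hmem := hβ.subset_of_notMem h hs ha hb hba hc (Finset.mem_union_left _ hz)
  have hzb : z ≠ b := by rintro rfl; exact hba hz
  simp only [Finset.mem_union, Finset.mem_insert, Finset.mem_singleton, hza, hzb, hzc, hz2,
    false_or] at hmem
  obtain ⟨y, hy⟩ := exists_fourth h hmem
  refine Or.inr ⟨y, ?_, hy⟩
  have := hβ.mem_of_mem g hg a z ha (hga ▸ hb) hz
  rwa [hmv z y hza hzc hz2 hy, hga] at this

theorem fourth_of_notMem (hβ : IsBlockMap B o k β) (h : IsTwoDesign B 2)
    (hs : HGSupersimple B) (ha : a ≠ o) (hb : b ≠ o) (hba : b ∉ β a)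
    (hc : b ∉ collinearThird B o a) {d e : Ω} (hd : d ∈ β a)
    (hl : ({o, a, d, e} : Finset Ω) ∈ B) :
    e ∈ collinearThird B a b ∨ e ∈ collinearThird B b o ∨ e ∈ β b := by
  have hab : a ≠ b := fun h => hba (h ▸ hβ.mem_self a ha)
  obtain ⟨g, hg, hga, hgb, -, -, hmv⟩ := exists_triangle h hs ha hb hab hc
  by_contra hcon
  simp only [not_or] at hcon
  have := hβ.mem_of_mem g hg a d ha (hga ▸ hb) hd
  rw [hmv d e hl hcon.1 hcon.2.1, hga] at this
  exact hcon.2.2 this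

end Triangle

/-- The points in the block of `a` that are collinear with `o` and `a`. -/
def inner (B : Finset (Finset Ω)) (o : Ω) (β : Ω → Finset Ω) (a : Ω) : Finset Ω :=
  (collinearThird B o a).filter (· ∈ β a)

open Classical in
/-- The points `z` on a line `{o, a, z, y}` with `z`, `y` in a common block not containing `a`. -/
noncomputable def outer (B : Finset (Finset Ω)) (o : Ω) (β : Ω → Finset Ω) (a : Ω) : Finset Ω :=
  (collinearThird B o a).filter fun z => z ∉ β a ∧ ∃ y ∈ β z, ({o, a, z, y} : Finset Ω) ∈ B

theorem card_inner_add_card_outer_le (h : IsTwoDesign B 2) (hs : HGSupersimple B) {a : Ω}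
    (ha : a ≠ o) : (inner B o β a).card + (outer B o β a).card ≤ 4 := by
  rw [← card_collinearThird h hs ha.symm, ← Finset.card_union_of_disjoint]
  · exact Finset.card_le_card
      (Finset.union_subset (Finset.filter_subset _ _) (Finset.filter_subset _ _))
  · rw [Finset.disjoint_left]
    intro z hz hz'
    simp only [inner, outer, Finset.mem_filter] at hz hz'
    exact hz'.2.1 hz.2

theorem sum_card_outer_le (h : IsTwoDesign B 2) (hs : HGSupersimple B) :
    ∑ a ∈ Finset.univ.erase o, (outer B o β a).card ≤
      ∑ a ∈ Finset.univ.erase o, (inner B o β a).card := by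
  rw [← Finset.card_sigma, ← Finset.card_sigma]
  refine Finset.card_le_card_of_forall_subsingleton
    (fun p q => q.1 = p.2 ∧ ({o, p.1, p.2, q.2} : Finset Ω) ∈ B) ?_ ?_
  · rintro ⟨a, z⟩ hp
    simp only [outer, Finset.mem_sigma, Finset.mem_filter] at hp
    obtain ⟨-, -, -, y, hy, hl⟩ := hp
    have d := h.distinct hl
    refine ⟨⟨z, y⟩, ?_, rfl, hl⟩
    simp only [inner, Finset.mem_sigma, Finset.mem_filter, Finset.mem_erase, Finset.mem_univ,
      and_true]
    exact ⟨by tauto, mem_collinearThird.2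
      ⟨by tauto, by tauto, by tauto, _, hl, by simp, by simp, by simp⟩, hy⟩
  · rintro ⟨z, y⟩ - ⟨a, z₁⟩ ⟨-, rfl, h1⟩ ⟨a', z₂⟩ ⟨-, h0, h2⟩
    dsimp only at h0 h1 h2
    subst h0
    have e : ∀ u : Ω, ({o, u, z, y} : Finset Ω) = {o, z, y, u} := fun u => by grind
    rw [e] at h1 h2
    rw [fourth_unique h hs h1 h2]

theorem card_lt_of_notMem (hβ : IsBlockMap B o k β) (h : IsTwoDesign B 2) (hs : HGSupersimple B)
    {a : Ω} (ha : a ≠ o) :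
    Fintype.card Ω + (inner B o β a).card ≤ k + 5 +
      (((Finset.univ.erase o) \ β a) \ collinearThird B o a).card := by
  have h1 : (Finset.univ.erase o).card = Fintype.card Ω - 1 := by
    rw [Finset.card_erase_of_mem (Finset.mem_univ o), Finset.card_univ]
  have h2 : ((Finset.univ.erase o) \ β a).card = Fintype.card Ω - 1 - k := by
    rw [Finset.card_sdiff_of_subset, h1, hβ.card_eq a ha]
    intro z hz
    simp [hβ.ne_of_mem ha hz]
  have h3 : ((Finset.univ.erase o) \ β a) \ collinearThird B o a =
      ((Finset.univ.erase o) \ β a) \ (collinearThird B o a \ β a) := by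
    ext z; simp only [Finset.mem_sdiff]; tauto
  have h4 := Finset.le_card_sdiff (collinearThird B o a \ β a) ((Finset.univ.erase o) \ β a)
  have h5 : (inner B o β a).card + (collinearThird B o a \ β a).card = 4 := by
    rw [← card_collinearThird h hs ha.symm, inner, Finset.filter_mem_eq_inter,
      Finset.card_inter_add_card_sdiff]
  rw [h3]
  have : 0 < Fintype.card Ω := Fintype.card_pos_iff.2 ⟨o⟩
  omega

theorem le_seven (hβ : IsBlockMap B o k β) (h : IsTwoDesign B 2) (hs : HGSupersimple B)
    {a : Ω} (ha : a ≠ o) (hk : k + 5 < Fintype.card Ω) : k ≤ 7 := by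
  have h1 := hβ.card_lt_of_notMem h hs ha
  obtain ⟨b, hb⟩ := Finset.card_pos.1
    (show 0 < (((Finset.univ.erase o) \ β a) \ collinearThird B o a).card by omega)
  simp only [Finset.mem_sdiff, Finset.mem_erase, Finset.mem_univ, and_true] at hb
  obtain ⟨⟨hbo, hba⟩, hc⟩ := hb
  have hab : a ≠ b := fun h => hba (h ▸ hβ.mem_self a ha)
  have h2 := Finset.card_le_card (hβ.subset_of_notMem h hs ha hbo hba hc)
  rw [Finset.card_union_of_disjoint
    (Finset.disjoint_left.2 fun z hz => hβ.notMem_of_mem ha hbo hba hz),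
    hβ.card_eq a ha, hβ.card_eq b hbo] at h2
  have c1 := card_collinearThird h hs ha.symm
  have c2 := card_collinearThird h hs hab
  have c3 := card_collinearThird h hs hbo
  have u1 := Finset.card_union_le {a, b} (collinearThird B o a ∪ (collinearThird B a b ∪
      collinearThird B b o))
  have u2 := Finset.card_union_le (collinearThird B o a) (collinearThird B a b ∪
      collinearThird B b o)
  have u3 := Finset.card_union_le (collinearThird B a b) (collinearThird B b o)
  have u4 := Finset.card_pair hab
  omega

/-- The key inequality for two points of a block that are not collinear with `o`. -/
theorem card_add_card_inner_le (hβ : IsBlockMap B o k β) (h : IsTwoDesign B 2)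
    (hs : HGSupersimple B) {a z : Ω} (ha : a ≠ o) (hz : z ∈ β a) (hza : z ≠ a)
    (hzc : z ∉ collinearThird B o a) :
    Fintype.card Ω + (inner B o β a).card ≤ k + 9 + (outer B o β z).card := by
  have h1 := hβ.card_lt_of_notMem h hs ha
  have h2 : ((Finset.univ.erase o) \ β a) \ collinearThird B o a ⊆
      collinearThird B a z ∪ outer B o β z := by
    intro b hb
    simp only [Finset.mem_sdiff, Finset.mem_erase, Finset.mem_univ, and_true] at hb
    obtain ⟨⟨hbo, hba⟩, hc⟩ := hb
    rw [Finset.mem_union]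
    rcases hβ.exists_line_of_notMem h hs ha hbo hba hc hz hza hzc with hm | ⟨y, hy, hl⟩
    · exact Or.inl (mem_collinearThird_swap.1 hm)
    · right
      rw [show ({b, o, z, y} : Finset Ω) = {o, z, b, y} by grind] at hl
      simp only [outer, Finset.mem_filter]
      exact ⟨mem_collinearThird_of_line h hl, by rwa [hβ.eq_of_mem a z ha hz], y, hy, hl⟩
  have h3 := (Finset.card_le_card h2).trans (Finset.card_union_le _ _)
  rw [card_collinearThird h hs hza.symm] at h3
  omega

/-- If the block of `a` lies in the union of the lines through `o` and `a`, there are few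
points. -/
theorem card_le_of_subset (hβ : IsBlockMap B o k β) (h : IsTwoDesign B 2)
    (hs : HGSupersimple B) (hk : 1 < k) {a : Ω} (ha : a ≠ o)
    (hsub : ∀ z ∈ β a, z ≠ a → z ∈ collinearThird B o a) :
    k ≤ 5 ∧ Fintype.card Ω ≤ k + 9 := by
  have hin : inner B o β a = (β a).erase a := by
    ext z
    simp only [inner, Finset.mem_filter, Finset.mem_erase]
    constructor
    · rintro ⟨h1, h2⟩
      exact ⟨(mem_collinearThird.1 h1).2.2.1, h2⟩
    · rintro ⟨h1, h2⟩
      exact ⟨hsub z h2 h1, h2⟩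
  have hin' : (inner B o β a).card = k - 1 := by
    rw [hin, Finset.card_erase_of_mem (hβ.mem_self a ha), hβ.card_eq a ha]
  have h4 := card_inner_add_card_outer_le (β := β) h hs ha
  refine ⟨by omega, ?_⟩
  obtain ⟨d, hd⟩ := Finset.card_pos.1 (show 0 < (inner B o β a).card by omega)
  simp only [inner, Finset.mem_filter] at hd
  obtain ⟨hdc, hd⟩ := hd
  obtain ⟨e, hl⟩ := exists_fourth h hdc
  have dd := h.distinct hl
  have heo : e ≠ o := by tauto
  have h1 := hβ.card_lt_of_notMem h hs ha
  have m1 : o ∈ collinearThird B a e := mem_collinearThird.2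
    ⟨by tauto, by tauto, by tauto, _, hl, by simp, by simp, by simp⟩
  have m2 : d ∈ collinearThird B a e := mem_collinearThird.2
    ⟨by tauto, by tauto, by tauto, _, hl, by simp, by simp, by simp⟩
  have m3 : a ∈ collinearThird B o e := mem_collinearThird.2
    ⟨by tauto, by tauto, by tauto, _, hl, by simp, by simp, by simp⟩
  have m4 : d ∈ collinearThird B o e := mem_collinearThird.2
    ⟨by tauto, by tauto, by tauto, _, hl, by simp, by simp, by simp⟩
  have h2 : ((Finset.univ.erase o) \ β a) \ collinearThird B o a ⊆
      ((collinearThird B a e).erase o).erase d ∪ (((collinearThird B o e).erase a).erase d ∪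
        (β e).erase e) := by
    intro b hb
    simp only [Finset.mem_sdiff, Finset.mem_erase, Finset.mem_univ, and_true] at hb
    obtain ⟨⟨hbo, hba⟩, hc⟩ := hb
    have hab : b ≠ a := fun h => hba (h ▸ hβ.mem_self a ha)
    have hbd : b ≠ d := fun h => hba (h ▸ hd)
    have hbe : b ≠ e := by
      rintro rfl
      exact hc (mem_collinearThird.2 ⟨by tauto, by tauto, by tauto, _, hl, by simp, by simp,
        by simp⟩)
    simp only [Finset.mem_union, Finset.mem_erase]
    rcases hβ.fourth_of_notMem h hs ha hbo hba hc hd hl with hm | hm | hm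
    · exact Or.inl ⟨hbd, hbo, mem_collinearThird_swap.1 hm⟩
    · rw [collinearThird_comm] at hm
      exact Or.inr (Or.inl ⟨hbd, hab, mem_collinearThird_swap.1 hm⟩)
    · exact Or.inr (Or.inr ⟨hbe, hβ.mem_symm hbo hm⟩)
  have h3 := (Finset.card_le_card h2).trans ((Finset.card_union_le _ _).trans
    (Nat.add_le_add_left (Finset.card_union_le _ _) _))
  rw [Finset.card_erase_of_mem, Finset.card_erase_of_mem m1, Finset.card_erase_of_mem,
    Finset.card_erase_of_mem m3, Finset.card_erase_of_mem (hβ.mem_self e heo), hβ.card_eq e heo,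
    card_collinearThird h hs (by tauto), card_collinearThird h hs (by tauto)] at h3
  · omega
  · exact Finset.mem_erase.2 ⟨by tauto, m4⟩
  · exact Finset.mem_erase.2 ⟨by tauto, m2⟩

/-- If every block contains, for each of its points, a second one not collinear with it and `o`,
then the number of points is bounded in terms of the block size. -/
theorem card_le_of_forall_exists (hβ : IsBlockMap B o k β) (h : IsTwoDesign B 2)
    (hs : HGSupersimple B) {a₀ : Ω} (ha₀ : a₀ ≠ o)
    (hex : ∀ a, a ≠ o → ∃ z ∈ β a, z ≠ a ∧ z ∉ collinearThird B o a) :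
    Fintype.card Ω ≤ k + 10 := by
  by_contra! hcon
  have key : ∀ x, x ≠ o → ∃ a, a ≠ o ∧
      2 + (inner B o β a).card ≤ (outer B o β x).card := by
    intro x hx
    obtain ⟨z, hz, hzx, hzc⟩ := hex x hx
    have hzo := hβ.ne_of_mem hx hz
    refine ⟨z, hzo, ?_⟩
    have := hβ.card_add_card_inner_le h hs hzo (hβ.mem_symm hx hz) hzx.symm
      (fun hm => hzc (mem_collinearThird_swap.1 hm))
    omega
  have hle : ∀ x, x ≠ o → (inner B o β x).card ≤ (outer B o β x).card := by
    intro x hx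
    obtain ⟨a, -, h1⟩ := key x hx
    have h2 := card_inner_add_card_outer_le (β := β) h hs hx
    omega
  have hlt : ∃ x, x ≠ o ∧ (inner B o β x).card < (outer B o β x).card := by
    obtain ⟨a, ha, h1⟩ := key a₀ ha₀
    obtain ⟨_, -, h2⟩ := key a ha
    have h3 := card_inner_add_card_outer_le (β := β) h hs ha₀
    by_cases h0 : (inner B o β a).card = 0
    · exact ⟨a, ha, by omega⟩
    · exact ⟨a₀, ha₀, by omega⟩
  obtain ⟨x, hx, hlt⟩ := hlt
  refine absurd (sum_card_outer_le (β := β) (o := o) h hs) (not_le.2 ?_)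
  exact Finset.sum_lt_sum (fun x hx => hle x (Finset.ne_of_mem_erase hx))
    ⟨x, Finset.mem_erase.2 ⟨hx, Finset.mem_univ x⟩, hlt⟩

end IsBlockMap

end Blocks

/-- (Lemma 6.9) If the hole stabilizer of a supersimple 2-(n,4,2)
design is transitive on `Ω \ {∞}` and preserves a system of imprimitivity, then
`n ≤ 13`. -/
theorem stmt19 (B : Finset (Finset Ω)) (n : ℕ) (hn : Fintype.card Ω = n)
    (hdes : IsTwoDesign B 2) (hss : HGSupersimple B) (x : Ω)
    (htrans : ∀ a b : Ω, a ≠ x → b ≠ x → ∃ g ∈ holeStab B x, g a = b)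
    (P : Finset (Finset Ω)) (k ℓ : ℕ) (hP : IsHoleBlockSystem B x P k ℓ) :
    n ≤ 13 := by
  subst hn
  by_contra! hn
  obtain ⟨β, hβ⟩ := hP.exists_isBlockMap
  have hcard := hP.card_eq
  have hdvd := hdes.three_dvd x
  obtain ⟨-, hk, hℓ, -⟩ := hP
  have hmul : 2 * k ≤ ℓ * k := Nat.mul_le_mul_right k hℓ
  obtain ⟨a₀, ha₀⟩ := Fintype.exists_ne_of_one_lt_card (by omega) x
  have h7 := hβ.le_seven hdes hss ha₀ (by omega)
  by_cases hex : ∀ a, a ≠ x → ∃ z ∈ β a, z ≠ a ∧ z ∉ collinearThird B x a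
  · have hle := hβ.card_le_of_forall_exists hdes hss ha₀ hex
    have hc : Fintype.card Ω - 1 = 15 := by omega
    rw [hc] at hcard
    interval_cases k <;> omega
  · push Not at hex
    obtain ⟨a, ha, hsub⟩ := hex
    have := hβ.card_le_of_subset hdes hss hk ha hsub
    omega
end
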